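/- Let L be a finitely generated S-module. If L is a Cohen-Macaulay S-module (depth L = dim L), then for almost all α the specialization L_α is a Cohen-Macaulay S_α-module. -/

import Mathlib

set_option maxHeartbeats 1000000
set_option synthInstance.maxHeartbeats 1000000

noncomputable section

namespace Spl

open MvPolynomial

/-- "Q(α) holds for almost all α ∈ K^m", i.e. away from a proper algebraic
subvariety of `K^m`. -/
def AlmostAll (K : Type) [Field K] (m : ℕ) (Q : (Fin m → K) → Prop) : Prop :=
  ∃ c : MvPolynomial (Fin m) K, c ≠ 0 ∧ ∀ α : Fin m → K, MvPolynomial.eval α c ≠ 0 → Q α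

variable (k K : Type) [Field k] [Field K] [Algebra k K]

/-- the field k(u) of rational functions in u = (u_1, ..., u_m) -/
abbrev kU (m : ℕ) := FractionRing (MvPolynomial (Fin m) k)

/-- the polynomial ring R = k(u)[X_1, ..., X_n] -/
abbrev Rg (m n : ℕ) := MvPolynomial (Fin n) (kU k m)

/-- the subfield k(α) ⊆ K generated by α = (α_1, ..., α_m) over k -/
abbrev kA {m : ℕ} (α : Fin m → K) := IntermediateField.adjoin k (Set.range α)

/-- the polynomial ring R_α = k(α)[X_1, ..., X_n] -/
abbrev Ra {m : ℕ} (n : ℕ) (α : Fin m → K) := MvPolynomial (Fin n) (kA k K α)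

/-- evaluation u ↦ α, from k[u] to k(α) -/
def evalα {m : ℕ} (α : Fin m → K) : MvPolynomial (Fin m) k →+* kA k K α :=
  (MvPolynomial.aeval fun i =>
    (⟨α i, IntermediateField.subset_adjoin k (Set.range α) ⟨i, rfl⟩⟩ : kA k K α)).toRingHom

/-- the inclusion k[u][X] → R = k(u)[X] -/
def toR (m n : ℕ) : MvPolynomial (Fin n) (MvPolynomial (Fin m) k) →+* Rg k m n :=
  MvPolynomial.map (algebraMap (MvPolynomial (Fin m) k) (kU k m))

/-- substitution u ↦ α, from k[u][X] to R_α = k(α)[X] -/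
def toRa {m : ℕ} (n : ℕ) (α : Fin m → K) :
    MvPolynomial (Fin n) (MvPolynomial (Fin m) k) →+* Ra k K n α :=
  MvPolynomial.map (evalα k K α)

/-- Krull's specialization I_α = { f(α,X) | f(u,X) ∈ I ∩ k[u,X] } of an ideal I ⊆ R
(as an ideal of R_α, i.e. the ideal spanned by the specialized elements). -/
def idealSpec {m : ℕ} (n : ℕ) (α : Fin m → K) (I : Ideal (Rg k m n)) :
    Ideal (Ra k K n α) :=
  Ideal.span (toRa k K n α '' { f | toR k m n f ∈ I })

/-- `ElemSpec k K n α f fα` : fα is the specialization of f ∈ R at α, i.e. writing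
f = p(u,X)/q(u) with q(α) ≠ 0 one has fα = p(α,X)/q(α). -/
def ElemSpec {m : ℕ} (n : ℕ) (α : Fin m → K) (f : Rg k m n) (fα : Ra k K n α) : Prop :=
  ∃ (p : MvPolynomial (Fin n) (MvPolynomial (Fin m) k)) (q : MvPolynomial (Fin m) k),
    evalα k K α q ≠ 0 ∧
    MvPolynomial.C (algebraMap (MvPolynomial (Fin m) k) (kU k m) q) * f = toR k m n p ∧
    MvPolynomial.C (evalα k K α q) * fα = toRa k K n α p

variable {k K}

/-- `LocElemSpec P ℘ a aα` : aα ∈ S_α = (R_α)_℘ is the specialization of a ∈ S = R_P,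
i.e. writing a = f/g with f, g ∈ R, g ∉ P, one has g_α ∉ ℘ and aα = f_α/g_α. -/
def LocElemSpec {m n : ℕ} {α : Fin m → K} (P : Ideal (Rg k m n)) [P.IsPrime]
    (℘ : Ideal (Ra k K n α)) [℘.IsPrime]
    {S : Type} [CommRing S] [Algebra (Rg k m n) S] [IsLocalization.AtPrime S P]
    {Sα : Type} [CommRing Sα] [Algebra (Ra k K n α) Sα] [IsLocalization.AtPrime Sα ℘]
    (a : S) (aα : Sα) : Prop :=
  ∃ (f g : Rg k m n) (fα gα : Ra k K n α) (hg : g ∈ P.primeCompl)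
    (hgα : gα ∈ ℘.primeCompl),
    ElemSpec k K n α f fα ∧ ElemSpec k K n α g gα ∧
    a = IsLocalization.mk' S f ⟨g, hg⟩ ∧
    aα = IsLocalization.mk' Sα fα ⟨gα, hgα⟩

/-- entrywise specialization of matrices, relative to an element-specialization
relation `E`. -/
def MatSpec {S T : Type} (E : S → T → Prop) {r s : ℕ}
    (A : Matrix (Fin r) (Fin s) S) (B : Matrix (Fin r) (Fin s) T) : Prop :=
  ∀ i j, E (A i j) (B i j)

/-- the cokernel of the linear map attached to a matrix A, i.e. the module
presented by A. -/
abbrev MatCoker {S : Type} [CommRing S] {r s : ℕ} (A : Matrix (Fin r) (Fin s) S) :=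
  (Fin r → S) ⧸ LinearMap.range A.mulVecLin

/-- a finite free presentation F_1 → F_0 → L → 0 of the module L, where the map
F_1 → F_0 is given by the matrix A and the map F_0 → L is π. -/
structure Present (S : Type) [CommRing S] (r s : ℕ) (L : Type) [AddCommGroup L]
    [Module S L] where
  A : Matrix (Fin r) (Fin s) S
  π : (Fin r → S) →ₗ[S] L
  surj : Function.Surjective π
  ker_eq : LinearMap.ker π = LinearMap.range A.mulVecLin

theorem comm_le {S : Type} [CommRing S] {r s r' s' : ℕ} {B : Matrix (Fin r) (Fin s) S}
    {C : Matrix (Fin r') (Fin s') S} {W : Matrix (Fin r') (Fin r) S}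
    {W1 : Matrix (Fin s') (Fin s) S} (h : W * B = C * W1) :
    LinearMap.range B.mulVecLin ≤ (LinearMap.range C.mulVecLin).comap W.mulVecLin := by
  rintro x ⟨y, rfl⟩
  exact ⟨W1.mulVecLin y, by
    simp only [Matrix.mulVecLin_apply, Matrix.mulVec_mulVec, h]⟩

/-- the map between the modules presented by B and C induced by the matrix W
(a specialization of a lift of a map between the presented modules). -/
def cokerMap {S : Type} [CommRing S] {r s r' s' : ℕ} {B : Matrix (Fin r) (Fin s) S}
    {C : Matrix (Fin r') (Fin s') S} (W : Matrix (Fin r') (Fin r) S)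
    (h : LinearMap.range B.mulVecLin ≤ (LinearMap.range C.mulVecLin).comap W.mulVecLin) :
    MatCoker B →ₗ[S] MatCoker C :=
  Submodule.mapQ _ _ W.mulVecLin h

/-- a lift of a homomorphism v : L → M to given finite free presentations of L and M:
a commutative diagram whose vertical maps are given by the matrices V1, V0. -/
structure MapLift {S : Type} [CommRing S] {rL sL rM sM : ℕ} {L M : Type}
    [AddCommGroup L] [Module S L] [AddCommGroup M] [Module S M]
    (pL : Present S rL sL L) (pM : Present S rM sM M) (v : L →ₗ[S] M) where
  V0 : Matrix (Fin rM) (Fin rL) S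
  V1 : Matrix (Fin sM) (Fin sL) S
  comm0 : pM.π ∘ₗ V0.mulVecLin = v ∘ₗ pL.π
  comm1 : V0 * pL.A = pM.A * V1

/-- Krull dimension of a module, dim L = dim S/Ann L. -/
def moduleDim (S : Type) [CommRing S] (L : Type) [AddCommGroup L] [Module S L] :
    WithBot ℕ∞ :=
  ringKrullDim (S ⧸ Module.annihilator S L)

/-- height of an ideal: the infimum of dim S_p over the primes p ⊇ I. -/
def idealHeight {S : Type} [CommRing S] (I : Ideal S) : WithBot ℕ∞ :=
  sInf { d | ∃ (p : Ideal S) (hp : p.IsPrime), I ≤ p ∧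
    d = ringKrullDim (Localization (@Ideal.primeCompl _ _ p hp)) }

/-- length of a module: the longest chain of submodules. -/
def moduleLength (S : Type) [CommRing S] (L : Type) [AddCommGroup L] [Module S L] :
    WithBot ℕ∞ :=
  Order.krullDim (Submodule S L)

/-- grade(𝔞, L) ≥ t : there is an L-regular sequence of length t in 𝔞. -/
def GradeGE {S : Type} [CommRing S] (𝔞 : Ideal S) (L : Type) [AddCommGroup L]
    [Module S L] (t : ℕ) : Prop :=
  ∃ rs : List S, rs.length = t ∧ (∀ x ∈ rs, x ∈ 𝔞) ∧ RingTheory.Sequence.IsRegular L rs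

/-- grade(𝔞, L) : the length of a maximal L-regular sequence in 𝔞. -/
def grade {S : Type} [CommRing S] (𝔞 : Ideal S) (L : Type) [AddCommGroup L]
    [Module S L] : ℕ∞ :=
  sSup { t : ℕ∞ | ∃ t' : ℕ, t = (t' : ℕ∞) ∧ GradeGE 𝔞 L t' }

/-- depth of a module over a local ring: grade(𝔪, L). -/
def depth (S : Type) [CommRing S] [IsLocalRing S] (L : Type) [AddCommGroup L]
    [Module S L] : ℕ∞ :=
  grade (IsLocalRing.maximalIdeal S) L

/-- proj dim L ≤ d : L admits a finite free resolution of length ≤ d, encoded as a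
(possibly infinite) free resolution ⋯ → F_1 → F_0 → L → 0 with F_j = 0 for j > d. -/
def ProjDimLE (S : Type) [CommRing S] (L : Type) [AddCommGroup L] [Module S L]
    (d : ℕ) : Prop :=
  ∃ (r : ℕ → ℕ) (A : ∀ j : ℕ, Matrix (Fin (r j)) (Fin (r (j + 1))) S)
    (π : (Fin (r 0) → S) →ₗ[S] L),
    Function.Surjective π ∧ LinearMap.ker π = LinearMap.range (A 0).mulVecLin ∧
    (∀ j : ℕ, LinearMap.ker (A j).mulVecLin = LinearMap.range (A (j + 1)).mulVecLin) ∧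
    ∀ j : ℕ, d < j → r j = 0

/-- projective dimension of a module, as an extended natural number. -/
def projDim (S : Type) [CommRing S] (L : Type) [AddCommGroup L] [Module S L] : ℕ∞ :=
  sInf { d : ℕ∞ | ∃ d' : ℕ, d = (d' : ℕ∞) ∧ ProjDimLE S L d' }

/-- the i-th local cohomology module H^i_𝔞(L) as a module. -/
abbrev localCoh {S : Type} [CommRing S] (𝔞 : Ideal S) (i : ℕ) (L : Type)
    [AddCommGroup L] [Module S L] : ModuleCat S :=
  (localCohomology 𝔞 i).obj (ModuleCat.of S L)

/-- the colon submodule (0 :_L 𝔞) = { x ∈ L | 𝔞 x = 0 }. -/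
def colonSubmodule {S : Type} [CommRing S] (𝔞 : Ideal S) (L : Type) [AddCommGroup L]
    [Module S L] : Submodule S L where
  carrier := { x | ∀ c ∈ 𝔞, c • x = 0 }
  add_mem' := by
    intro a b ha hb c hc
    rw [smul_add, ha c hc, hb c hc, add_zero]
  zero_mem' := by
    intro c _
    rw [smul_zero]
  smul_mem' := by
    intro s x hx c hc
    rw [smul_comm, hx c hc, smul_zero]

/-- a (partial) system of parameters: the d = dim L elements a_1, ..., a_d lie in the
maximal ideal and L/(a_1, ..., a_d)L has dimension ≤ 0. -/
def IsSOP (S : Type) [CommRing S] [IsLocalRing S] (L : Type) [AddCommGroup L]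
    [Module S L] {d : ℕ} (a : Fin d → S) : Prop :=
  (∀ i, a i ∈ IsLocalRing.maximalIdeal S) ∧
  moduleDim S L = (d : ℕ∞) ∧
  moduleDim S (L ⧸ (Ideal.span (Set.range a) • (⊤ : Submodule S L))) ≤ 0

/-- a standard system of parameters: (a_1, ..., a_d) H^i_𝔪(L/(a_1, ..., a_j)L) = 0
for all i + j < d. -/
def IsStandardSOP (S : Type) [CommRing S] [IsLocalRing S] (L : Type) [AddCommGroup L]
    [Module S L] {d : ℕ} (a : Fin d → S) : Prop :=
  IsSOP S L a ∧
  ∀ i j : ℕ, i + j < d →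
    Ideal.span (Set.range a) ≤ Module.annihilator S
      (localCoh (IsLocalRing.maximalIdeal S) i
        (L ⧸ (Ideal.span (a '' { x : Fin d | (x : ℕ) < j }) • (⊤ : Submodule S L))))

/-- a standard ideal for L: an 𝔪-primary ideal 𝔞 such that every system of
parameters of L contained in 𝔞 is standard. -/
def IsStandardIdeal (S : Type) [CommRing S] [IsLocalRing S] (L : Type) [AddCommGroup L]
    [Module S L] (𝔞 : Ideal S) : Prop :=
  𝔞.radical = IsLocalRing.maximalIdeal S ∧
  ∀ (d : ℕ) (a : Fin d → S), (∀ i, a i ∈ 𝔞) → IsSOP S L a → IsStandardSOP S L a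

/-- `μ` is the largest index in the support of `f`. -/
def IsLead {J D : Type*} [LT J] [Zero D] (f : J →₀ D) (μ : J) : Prop :=
  f μ ≠ 0 ∧ ∀ ν, μ < ν → f ν = 0

section Lead

variable {J D E : Type*} [LinearOrder J]

theorem exists_isLead [Zero D] {f : J →₀ D} (hf : f ≠ 0) : ∃ μ, IsLead f μ := by
  have hne := Finsupp.support_nonempty_iff.mpr hf
  refine ⟨f.support.max' hne, by simpa using f.support.max'_mem hne, fun ν hν => ?_⟩
  by_contra h
  exact absurd (f.support.le_max' ν (by simpa using h)) (not_le.mpr hν)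

theorem IsLead.mapRange [Semiring D] [Semiring E] (ev : D →+* E) {f : J →₀ D} {μ : J}
    (h : IsLead f μ) (hμ : ev (f μ) ≠ 0) :
    IsLead (Finsupp.mapRange ev (map_zero ev) f) μ :=
  ⟨by simpa using hμ, fun ν hν => by simp [h.2 ν hν]⟩

/-- A nontrivial combination of vectors with distinct leading indices does not vanish at one
of these indices. -/
theorem exists_linearCombination_apply_ne_zero [CommRing D] [IsDomain D] {w : J → J →₀ D}
    {t : J →₀ D} (ht : t ≠ 0) (hw : ∀ μ ∈ t.support, IsLead (w μ) μ) :
    ∃ μ ∈ t.support, Finsupp.linearCombination D w t μ ≠ 0 := by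
  obtain ⟨μ, hμ, hmax⟩ := exists_isLead ht
  have hμs : μ ∈ t.support := by simpa using hμ
  refine ⟨μ, hμs, ?_⟩
  rw [Finsupp.linearCombination_apply, Finsupp.sum, Finsupp.finsetSum_apply,
    Finset.sum_eq_single μ]
  · simpa using ⟨hμ, (hw μ hμs).1⟩
  · intro ν hν hne
    rcases lt_or_gt_of_ne hne with h | h
    · simp [(hw ν hν).2 μ h]
    · simp [hmax ν h]
  · intro h
    exact absurd hμs h

variable [CommRing D]

/-- `w` picks, for each leading index of a vector of `V`, a vector of `V` having this leading
index and a leading coefficient dividing `c`. -/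
def IsLeadSystem (V : Submodule D (J →₀ D)) (c : D) (w : J → J →₀ D) : Prop :=
  ∀ v ∈ V, ∀ μ, IsLead v μ → w μ ∈ V ∧ IsLead (w μ) μ ∧ w μ μ ∣ c

/-- The leading indices of the vectors of `V`. -/
def leadSet (V : Submodule D (J →₀ D)) : Set J := { μ | ∃ v ∈ V, IsLead v μ }

variable [WellFoundedLT J] {V : Submodule D (J →₀ D)} {c : D} {w : J → J →₀ D}

theorem IsLeadSystem.exists_pow_smul_mem_span (hw : IsLeadSystem V c w) {v : J →₀ D}
    (hv : v ∈ V) : ∃ N : ℕ, c ^ N • v ∈ Submodule.span D (w '' leadSet V) := by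
  suffices H : ∀ μ : J, ∀ v ∈ V, IsLead v μ →
      ∃ N : ℕ, c ^ N • v ∈ Submodule.span D (w '' leadSet V) by
    by_cases h0 : v = 0
    · exact ⟨0, by simp [h0]⟩
    · obtain ⟨μ, hμ⟩ := exists_isLead h0
      exact H μ v hv hμ
  intro μ
  induction μ using WellFoundedLT.induction with
  | ind μ ih =>
    intro v hv hμ
    obtain ⟨hwV, hwl, a, ha⟩ := hw v hv μ hμ
    have hmem : w μ ∈ Submodule.span D (w '' leadSet V) :=
      Submodule.subset_span ⟨μ, ⟨v, hv, hμ⟩, rfl⟩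
    have hv' : c • v - (a * v μ) • w μ ∈ V := V.sub_mem (V.smul_mem _ hv) (V.smul_mem _ hwV)
    by_cases h0 : c • v - (a * v μ) • w μ = 0
    · refine ⟨1, ?_⟩
      rw [pow_one, sub_eq_zero.mp h0]
      exact Submodule.smul_mem _ _ hmem
    · obtain ⟨ν, hν⟩ := exists_isLead h0
      have hlt : ν < μ := by
        by_contra hge
        apply hν.1
        rcases eq_or_lt_of_le (not_lt.mp hge) with h | h
        · subst h
          simp only [Finsupp.coe_sub, Finsupp.coe_smul, Pi.sub_apply, Pi.smul_apply,
            smul_eq_mul, ha]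
          ring
        · simp [hμ.2 ν h, hwl.2 ν h]
      obtain ⟨N, hN⟩ := ih ν hlt _ hv' hν
      refine ⟨N + 1, ?_⟩
      have : c ^ (N + 1) • v = c ^ N • (c • v - (a * v μ) • w μ)
          + (c ^ N * (a * v μ)) • w μ := by
        rw [smul_sub, smul_smul, smul_smul, pow_succ]; abel
      rw [this]
      exact Submodule.add_mem _ hN (Submodule.smul_mem _ _ hmem)

theorem IsLeadSystem.exists_pow_smul_mem_sup (hw : IsLeadSystem V c w) (f : J →₀ D) :
    ∃ N : ℕ, c ^ N • f ∈ V ⊔ Finsupp.supported D D (leadSet V)ᶜ := by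
  have mono : ∀ {g : J →₀ D} {a b : ℕ}, a ≤ b →
      c ^ a • g ∈ V ⊔ Finsupp.supported D D (leadSet V)ᶜ →
      c ^ b • g ∈ V ⊔ Finsupp.supported D D (leadSet V)ᶜ := by
    intro g a b hab h
    rw [← Nat.sub_add_cancel hab, pow_add, mul_smul]
    exact Submodule.smul_mem _ _ h
  have sums : ∀ g : J →₀ D, (∀ μ ∈ g.support,
      ∃ N : ℕ, c ^ N • Finsupp.single μ (1 : D) ∈ V ⊔ Finsupp.supported D D (leadSet V)ᶜ) →
      ∃ N : ℕ, c ^ N • g ∈ V ⊔ Finsupp.supported D D (leadSet V)ᶜ := by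
    intro g hg
    choose! N hN using hg
    refine ⟨g.support.sup N, ?_⟩
    have hsum : g = ∑ μ ∈ g.support, g μ • Finsupp.single μ (1 : D) := by
      simpa [Finsupp.sum] using (Finsupp.sum_single g).symm
    generalize hM : g.support.sup N = M
    rw [hsum, Finset.smul_sum]
    refine Submodule.sum_mem _ fun μ hμ => ?_
    rw [smul_comm]
    subst hM
    exact Submodule.smul_mem _ _ (mono (Finset.le_sup hμ) (hN μ hμ))
  suffices H : ∀ μ : J, ∃ N : ℕ, c ^ N • Finsupp.single μ (1 : D) ∈
      V ⊔ Finsupp.supported D D (leadSet V)ᶜ from sums f fun μ _ => H μ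
  intro μ
  induction μ using WellFoundedLT.induction with
  | ind μ ih =>
    by_cases hμ : μ ∈ leadSet V
    · obtain ⟨v, hv, hvμ⟩ := hμ
      obtain ⟨hwV, hwl, a, ha⟩ := hw v hv μ hvμ
      obtain ⟨N, hN⟩ := sums (c • Finsupp.single μ 1 - a • w μ) (by
        intro ν hν
        refine ih ν ?_
        by_contra hge
        apply (Finsupp.mem_support_iff.mp hν)
        rcases eq_or_lt_of_le (not_lt.mp hge) with h | h
        · subst h
          simp [ha, mul_comm]
        · simp [hwl.2 ν h, h.ne])
      refine ⟨N + 1, ?_⟩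
      have : c ^ (N + 1) • Finsupp.single μ (1 : D)
          = c ^ N • (c • Finsupp.single μ 1 - a • w μ) + (c ^ N * a) • w μ := by
        rw [smul_sub, smul_smul, smul_smul, pow_succ]; abel
      rw [this]
      exact Submodule.add_mem _ hN
        (Submodule.mem_sup_left (Submodule.smul_mem _ _ hwV))
    · refine ⟨0, Submodule.mem_sup_right ?_⟩
      rw [pow_zero, one_smul]
      exact Finsupp.single_mem_supported D 1 hμ

end Lead

section Groebner

variable (σ : Type*) [LinearOrder σ] [Finite σ] (r : ℕ)

/-- Positions of monomials in vectors of length `r`, ordered position over term. -/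
abbrev TermIdx := Fin r ×ₗ (MonomialOrder.lex (σ := σ)).syn

/-- Coordinates of a vector of polynomials with respect to the monomials. -/
def coords (D : Type*) [CommRing D] :
    (Fin r → MvPolynomial σ D) ≃ₗ[D] (TermIdx σ r →₀ D) :=
  ((Pi.basis fun _ : Fin r => basisMonomials σ D).reindex
    (((Equiv.sigmaEquivProd _ _).trans
      (Equiv.prodCongr (Equiv.refl _)
        (MonomialOrder.lex (σ := σ)).toSyn.toEquiv)).trans toLex)).repr

variable {σ r} {D E : Type*} [CommRing D] [CommRing E]

theorem coords_apply (v : Fin r → MvPolynomial σ D) (μ : TermIdx σ r) :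
    coords σ r D v μ = coeff ((MonomialOrder.lex (σ := σ)).toSyn.symm (ofLex μ).2)
      (v (ofLex μ).1) := by
  rw [coords, Module.Basis.repr_reindex_apply, Pi.basis_repr]
  rfl

theorem isLead_coords_monomial_smul {v : Fin r → MvPolynomial σ D} {i : Fin r} {s : σ →₀ ℕ}
    (τ : σ →₀ ℕ) (h : IsLead (coords σ r D v) (toLex (i, MonomialOrder.lex.toSyn s))) :
    IsLead (coords σ r D (monomial τ (1 : D) • v))
      (toLex (i, MonomialOrder.lex.toSyn (τ + s))) ∧
    coords σ r D (monomial τ (1 : D) • v) (toLex (i, MonomialOrder.lex.toSyn (τ + s))) =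
      coords σ r D v (toLex (i, MonomialOrder.lex.toSyn s)) := by
  have key : coords σ r D (monomial τ (1 : D) • v)
      (toLex (i, MonomialOrder.lex.toSyn (τ + s))) =
      coords σ r D v (toLex (i, MonomialOrder.lex.toSyn s)) := by
    simp only [coords_apply, ofLex_toLex, AddEquiv.symm_apply_apply, Pi.smul_apply, smul_eq_mul]
    rw [coeff_monomial_mul, one_mul]
  refine ⟨⟨by rw [key]; exact h.1, ?_⟩, key⟩
  intro ν hν
  obtain ⟨⟨j, ρ⟩, rfl⟩ := toLex.surjective ν
  obtain ⟨ρ, rfl⟩ := MonomialOrder.lex.toSyn.surjective ρ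
  simp only [coords_apply, ofLex_toLex, AddEquiv.symm_apply_apply, Pi.smul_apply, smul_eq_mul]
  rw [coeff_monomial_mul']
  split_ifs with hτ
  · obtain ⟨ρ', rfl⟩ := exists_add_of_le hτ
    have := h.2 (toLex (j, MonomialOrder.lex.toSyn ρ')) (by
      rw [Prod.Lex.toLex_lt_toLex] at hν ⊢
      refine hν.imp id fun h' => ⟨h'.1, ?_⟩
      have h2 := h'.2
      simp only [map_add] at h2
      exact lt_of_add_lt_add_left h2)
    simpa [coords_apply] using this
  · rfl

/-- The coordinates of the vectors in a submodule. -/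
def coordsSub (V : Submodule (MvPolynomial σ D) (Fin r → MvPolynomial σ D)) :
    Submodule D (TermIdx σ r →₀ D) :=
  (V.restrictScalars D).map (coords σ r D).toLinearMap

theorem mem_coordsSub {V : Submodule (MvPolynomial σ D) (Fin r → MvPolynomial σ D)}
    {v : Fin r → MvPolynomial σ D} : coords σ r D v ∈ coordsSub V ↔ v ∈ V := by
  simp [coordsSub]

theorem exists_isLeadSystem [IsDomain D]
    (V : Submodule (MvPolynomial σ D) (Fin r → MvPolynomial σ D)) :
    ∃ c : D, c ≠ 0 ∧ ∃ w, IsLeadSystem (coordsSub V) c w := by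
  classical
  let Λ : Fin r → Set (σ →₀ ℕ) := fun i =>
    { s | ∃ v ∈ V, IsLead (coords σ r D v) (toLex (i, MonomialOrder.lex.toSyn s)) }
  let G : Fin r → Set (σ →₀ ℕ) := fun i => { s | Minimal (· ∈ Λ i) s }
  have hG : ∀ i, (G i).Finite := fun i =>
    WellQuasiOrderedLE.finite_of_isAntichain (setOfPred_minimal_antichain _)
  have hch : ∀ i s, ∃ v, s ∈ Λ i → v ∈ V ∧
      IsLead (coords σ r D v) (toLex (i, MonomialOrder.lex.toSyn s)) := by
    intro i s
    by_cases h : s ∈ Λ i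
    · obtain ⟨v, hv⟩ := h
      exact ⟨v, fun _ => hv⟩
    · exact ⟨0, fun h' => absurd h' h⟩
  choose g hg using hch
  let lc : Fin r → (σ →₀ ℕ) → D := fun i s =>
    coords σ r D (g i s) (toLex (i, MonomialOrder.lex.toSyn s))
  refine ⟨∏ i, ∏ s ∈ (hG i).toFinset, lc i s, ?_, ?_⟩
  · refine Finset.prod_ne_zero_iff.mpr fun i _ => Finset.prod_ne_zero_iff.mpr fun s hs => ?_
    exact (hg i s ((hG i).mem_toFinset.mp hs).1).2.1
  · have : ∀ μ : TermIdx σ r, ∃ u : TermIdx σ r →₀ D, ∀ v ∈ coordsSub V, IsLead v μ →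
        u ∈ coordsSub V ∧ IsLead u μ ∧ u μ ∣ ∏ i, ∏ s ∈ (hG i).toFinset, lc i s := by
      intro μ
      by_cases hμ : ∃ v ∈ coordsSub V, IsLead v μ
      · obtain ⟨v, hv, hvμ⟩ := hμ
        obtain ⟨⟨i, s⟩, rfl⟩ := toLex.surjective μ
        obtain ⟨s, rfl⟩ := MonomialOrder.lex.toSyn.surjective s
        obtain ⟨v, rfl⟩ := (coords σ r D).surjective v
        have hs : s ∈ Λ i := ⟨v, mem_coordsSub.mp hv, hvμ⟩
        obtain ⟨b, hbs, hb⟩ := exists_minimal_le_of_wellFoundedLT (· ∈ Λ i) s hs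
        obtain ⟨τ, rfl⟩ := exists_add_of_le hbs
        have hgb := hg i b hb.1
        have hl := isLead_coords_monomial_smul τ hgb.2
        rw [add_comm τ b] at hl
        refine ⟨coords σ r D (monomial τ (1 : D) • g i b), fun _ _ _ =>
          ⟨mem_coordsSub.mpr (V.smul_mem _ hgb.1), hl.1, ?_⟩⟩
        rw [hl.2]
        exact (Finset.dvd_prod_of_mem (lc i) ((hG i).mem_toFinset.mpr hb)).trans
          (Finset.dvd_prod_of_mem (fun i => ∏ s ∈ (hG i).toFinset, lc i s) (Finset.mem_univ i))
      · exact ⟨0, fun v hv h => absurd ⟨v, hv, h⟩ hμ⟩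
    choose w hw using this
    exact ⟨w, fun v hv μ h => hw μ v hv h⟩

end Groebner

section Sat

variable {R M : Type*} [CommRing R] [AddCommGroup M] [Module R M]

/-- The elements a power of `a` multiplies into `W`. -/
def powSat (a : R) (W : Submodule R M) : Submodule R M where
  carrier := { x | ∃ N : ℕ, a ^ N • x ∈ W }
  zero_mem' := ⟨0, by simp⟩
  add_mem' := by
    rintro x y ⟨N, hN⟩ ⟨N', hN'⟩
    refine ⟨N + N', ?_⟩
    rw [smul_add]
    refine W.add_mem ?_ ?_
    · rw [add_comm, pow_add, mul_smul]
      exact W.smul_mem _ hN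
    · rw [pow_add, mul_smul]
      exact W.smul_mem _ hN'
  smul_mem' := by
    rintro b x ⟨N, hN⟩
    exact ⟨N, by rw [smul_comm]; exact W.smul_mem _ hN⟩

end Sat

section MapVec

variable {σ ι D E : Type*} [CommRing D] [CommRing E]

/-- Coefficientwise application of a ring homomorphism to a family of polynomials. -/
def mapFam (ev : D →+* E) : (ι → MvPolynomial σ D) →ₛₗ[ev] (ι → MvPolynomial σ E) where
  toFun v := fun i => MvPolynomial.map ev (v i)
  map_add' := by intros; ext; simp
  map_smul' := by intros; ext1; simp [MvPolynomial.smul_eq_C_mul]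

theorem mapFam_apply (ev : D →+* E) (v : ι → MvPolynomial σ D) (i : ι) :
    mapFam ev v i = MvPolynomial.map ev (v i) := rfl

theorem mapFam_smul (ev : D →+* E) (p : MvPolynomial σ D) (v : ι → MvPolynomial σ D) :
    mapFam ev (p • v) = MvPolynomial.map ev p • mapFam ev v := by
  ext1 i; simp [mapFam_apply]

/-- The submodule generated by the images of the vectors of `V`. -/
def specSub (ev : D →+* E) (V : Submodule (MvPolynomial σ D) (ι → MvPolynomial σ D)) :
    Submodule (MvPolynomial σ E) (ι → MvPolynomial σ E) :=
  Submodule.span _ (mapFam ev '' V)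

theorem mapFam_mem_specSub (ev : D →+* E)
    {V : Submodule (MvPolynomial σ D) (ι → MvPolynomial σ D)} {v : ι → MvPolynomial σ D}
    (hv : v ∈ V) : mapFam ev v ∈ specSub ev V :=
  Submodule.subset_span ⟨v, hv, rfl⟩

theorem restrictScalars_specSub (ev : D →+* E)
    (V : Submodule (MvPolynomial σ D) (ι → MvPolynomial σ D)) :
    (specSub ev V).restrictScalars E = Submodule.span E (mapFam ev '' V) := by
  apply le_antisymm
  · intro x hx
    rw [Submodule.restrictScalars_mem] at hx
    induction hx using Submodule.span_induction with
    | mem x hx => exact Submodule.subset_span hx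
    | zero => exact Submodule.zero_mem _
    | add x y _ _ hx hy => exact Submodule.add_mem _ hx hy
    | smul p x hxV hx =>
      clear hxV
      induction p using MvPolynomial.induction_on' with
      | monomial τ a =>
        induction hx using Submodule.span_induction with
        | mem x hx =>
          obtain ⟨v, hv, rfl⟩ := hx
          have : monomial τ a • mapFam ev v = a • mapFam ev (monomial τ (1 : D) • v) := by
            rw [mapFam_smul, map_monomial, map_one, ← smul_assoc, smul_monomial, smul_eq_mul,
              mul_one]
          rw [this]
          exact Submodule.smul_mem _ _ (Submodule.subset_span ⟨_, V.smul_mem _ hv, rfl⟩)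
        | zero => simp
        | add x y _ _ hx hy => rw [smul_add]; exact Submodule.add_mem _ hx hy
        | smul b x _ hx => rw [smul_comm]; exact Submodule.smul_mem _ _ hx
      | add p q hp hq => rw [add_smul]; exact Submodule.add_mem _ hp hq
  · rw [Submodule.span_le]
    exact fun x hx => Submodule.subset_span hx

theorem specSub_top [Finite ι] (ev : D →+* E) :
    specSub ev (⊤ : Submodule (MvPolynomial σ D) (ι → MvPolynomial σ D)) = ⊤ := by
  classical
  have := Fintype.ofFinite ι
  rw [eq_top_iff]
  intro x _
  rw [← Finset.univ_sum_single x]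
  refine Submodule.sum_mem _ fun i _ => ?_
  have : Pi.single i (x i) = x i • mapFam ev (Pi.single i (1 : MvPolynomial σ D)) := by
    ext1 j
    by_cases h : j = i
    · subst h; simp [mapFam_apply]
    · simp [mapFam_apply, h]
  rw [this]
  exact Submodule.smul_mem _ _ (mapFam_mem_specSub ev trivial)

theorem span_range_mapFam [Finite ι] (ev : D →+* E) :
    Submodule.span E (Set.range (mapFam (σ := σ) (ι := ι) ev)) = ⊤ := by
  have := restrictScalars_specSub ev (⊤ : Submodule (MvPolynomial σ D) (ι → MvPolynomial σ D))
  rw [specSub_top] at this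
  simpa using this.symm

theorem mapFam_mulVec {κ : Type*} [Fintype κ] (ev : D →+* E)
    (M : Matrix ι κ (MvPolynomial σ D)) (v : κ → MvPolynomial σ D) :
    mapFam ev (M.mulVec v) = (M.map (MvPolynomial.map ev)).mulVec (mapFam ev v) := by
  ext1 i
  simp [mapFam_apply, Matrix.mulVec, dotProduct, map_sum]

/-- Coefficientwise application of a ring homomorphism to finitely supported functions. -/
def mapCoords {J : Type*} (ev : D →+* E) : (J →₀ D) →ₛₗ[ev] (J →₀ E) where
  toFun := Finsupp.mapRange ev (map_zero ev)
  map_add' x y := Finsupp.mapRange_add (by simp) x y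
  map_smul' := by intros; ext; simp

theorem coords_mapFam [LinearOrder σ] [Finite σ] {r : ℕ} (ev : D →+* E)
    (v : Fin r → MvPolynomial σ D) :
    coords σ r E (mapFam ev v) = mapCoords ev (coords σ r D v) := by
  ext μ
  simp [coords_apply, mapFam_apply, mapCoords, coeff_map]

theorem IsLeadSystem.isLead_mapCoords {J : Type*} [LinearOrder J] {V : Submodule D (J →₀ D)}
    {c : D} {w : J → J →₀ D} (hw : IsLeadSystem V c w) {ev : D →+* E} (hev : ev c ≠ 0) {μ : J}
    (hμ : μ ∈ leadSet V) : IsLead (mapCoords ev (w μ)) μ := by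
  obtain ⟨v, hv, hvμ⟩ := hμ
  obtain ⟨-, hl, hd⟩ := hw v hv μ hvμ
  refine hl.mapRange ev fun h0 => hev ?_
  exact zero_dvd_iff.mp (h0 ▸ map_dvd ev hd)

end MapVec

section Generic

variable {σ : Type*} [LinearOrder σ] [Finite σ] {r : ℕ} {D : Type*} [CommRing D] [IsDomain D]

/-- Generic freeness: after specialization, the quotient by `V` has only torsion coming from
powers of a fixed element of the base. -/
theorem exists_torsion_bound (V : Submodule (MvPolynomial σ D) (Fin r → MvPolynomial σ D)) :
    ∃ c : D, c ≠ 0 ∧ ∀ {E : Type} [CommRing E] [IsDomain E] (ev : D →+* E), ev c ≠ 0 →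
      ∀ (w : E) (z : Fin r → MvPolynomial σ E), w ≠ 0 → w • z ∈ specSub ev V →
        ∃ N : ℕ, ev c ^ N • z ∈ specSub ev V := by
  obtain ⟨c, hc, u, hu⟩ := exists_isLeadSystem V
  refine ⟨c, hc, fun {E} _ _ ev hev w z hw hz => ?_⟩
  let Λ := leadSet (coordsSub V)
  let W : Submodule E (TermIdx σ r →₀ E) :=
    Submodule.span E ((fun μ => mapCoords ev (u μ)) '' Λ)
  have hspan : ∀ y ∈ specSub ev V, coords σ r E y ∈ powSat (ev c) W := by
    have : Submodule.span E (mapFam ev '' (V : Set _)) ≤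
        (powSat (ev c) W).comap (coords σ r E).toLinearMap := by
      rw [Submodule.span_le]
      rintro _ ⟨v, hv, rfl⟩
      obtain ⟨N, hN⟩ := hu.exists_pow_smul_mem_span (mem_coordsSub.mpr hv)
      refine ⟨N, ?_⟩
      have h2 : Submodule.span D (u '' Λ) ≤ W.comap (mapCoords ev) := by
        rw [Submodule.span_le]
        rintro _ ⟨μ, hμ, rfl⟩
        exact Submodule.subset_span ⟨μ, hμ, rfl⟩
      have h3 := h2 hN
      rw [Submodule.mem_comap, map_smulₛₗ, map_pow, ← coords_mapFam] at h3
      exact h3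
    intro y hy
    exact this (by rw [← restrictScalars_specSub]; exact hy)
  have hdiv : z ∈ powSat (ev c) ((specSub ev V).restrictScalars E ⊔
      (Finsupp.supported E E Λᶜ).comap (coords σ r E).toLinearMap) := by
    have : (⊤ : Submodule E (Fin r → MvPolynomial σ E)) ≤
        powSat (ev c) ((specSub ev V).restrictScalars E ⊔
          (Finsupp.supported E E Λᶜ).comap (coords σ r E).toLinearMap) := by
      rw [← span_range_mapFam ev, Submodule.span_le]
      rintro _ ⟨v, rfl⟩
      obtain ⟨N, hN⟩ := hu.exists_pow_smul_mem_sup (coords σ r D v)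
      refine ⟨N, ?_⟩
      obtain ⟨p, hp, q, hq, hpq⟩ := Submodule.mem_sup.mp hN
      obtain ⟨p, rfl⟩ := (coords σ r D).surjective p
      obtain ⟨q, rfl⟩ := (coords σ r D).surjective q
      rw [← map_add, ← map_smul] at hpq
      have hpq' := (coords σ r D).injective hpq
      rw [← map_pow, ← map_smulₛₗ, ← hpq', map_add]
      refine Submodule.add_mem_sup (mapFam_mem_specSub ev (mem_coordsSub.mp hp)) ?_
      rw [Submodule.mem_comap, LinearEquiv.coe_coe, coords_mapFam, Finsupp.mem_supported']
      intro μ hμ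
      have := (Finsupp.mem_supported' D _).mp hq μ hμ
      simp [mapCoords, this]
    exact this trivial
  obtain ⟨N, hN⟩ := hdiv
  obtain ⟨p, hp, y, hy, hpy⟩ := Submodule.mem_sup.mp hN
  have hwy : w • y ∈ specSub ev V := by
    have : w • y = ev c ^ N • (w • z) - w • p := by
      rw [smul_comm, ← hpy, smul_add]; abel
    rw [this]
    exact Submodule.sub_mem ((specSub ev V).restrictScalars E) (Submodule.smul_mem _ _ hz)
      (Submodule.smul_mem _ _ hp)
  obtain ⟨M, hM⟩ := hspan _ hwy
  obtain ⟨t, ht, htM⟩ := (Finsupp.mem_span_image_iff_linearCombination E).mp hM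
  have ht0 : t = 0 := by
    by_contra hne
    obtain ⟨μ, hμ, h⟩ := exists_linearCombination_apply_ne_zero
      (w := fun μ => mapCoords ev (u μ)) hne
      (fun μ hμ => hu.isLead_mapCoords hev (ht hμ))
    apply h
    have hyμ := (Finsupp.mem_supported' E _).mp hy μ (by simpa using ht hμ)
    rw [LinearEquiv.coe_coe] at hyμ
    rw [htM, map_smul]
    simp [hyμ]
  have hy0 : y = 0 := by
    rw [ht0, map_zero, ← map_smul, smul_smul] at htM
    have h0 := (coords σ r E).map_eq_zero_iff.mp htM.symm
    ext1 i
    have h1 := congrFun h0 i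
    rw [Pi.smul_apply, Pi.zero_apply, MvPolynomial.smul_eq_C_mul, mul_eq_zero] at h1
    refine h1.resolve_left ?_
    rw [MvPolynomial.C_eq_zero]
    exact mul_ne_zero (pow_ne_zero _ hev) hw
  exact ⟨N, by rw [← hpy, hy0, add_zero]; exact hp⟩

/-- Generically, the kernel of a matrix of polynomials commutes with specialization. -/
theorem exists_ker_specialization {ι : Type*} [Fintype ι]
    (M : Matrix (Fin r) ι (MvPolynomial σ D)) :
    ∃ c : D, c ≠ 0 ∧ ∀ {E : Type} [Field E] (ev : D →+* E), ev c ≠ 0 →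
      ∀ b : ι → MvPolynomial σ E, (M.map (MvPolynomial.map ev)).mulVec b = 0 →
        b ∈ specSub ev (LinearMap.ker M.mulVecLin) := by
  obtain ⟨c, hc, w, hw⟩ := exists_isLeadSystem (LinearMap.range M.mulVecLin)
  refine ⟨c, hc, fun {E} _ ev hev b hb => ?_⟩
  let V := coordsSub (LinearMap.range M.mulVecLin)
  let φ : (ι → MvPolynomial σ D) →ₗ[D] (TermIdx σ r →₀ D) :=
    (coords σ r D).toLinearMap ∘ₗ M.mulVecLin.restrictScalars D
  let ψ : (ι → MvPolynomial σ E) →ₗ[E] (TermIdx σ r →₀ E) :=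
    (coords σ r E).toLinearMap ∘ₗ (M.map (MvPolynomial.map ev)).mulVecLin.restrictScalars E
  have hψ : ∀ x, ψ (mapFam ev x) = mapCoords ev (φ x) := by
    intro x
    simp only [ψ, φ, LinearMap.coe_comp, Function.comp_apply, LinearMap.coe_restrictScalars,
      LinearEquiv.coe_coe, Matrix.mulVecLin_apply]
    rw [← mapFam_mulVec, coords_mapFam]
  have hu : ∀ μ, ∃ u : ι → MvPolynomial σ D, μ ∈ leadSet V → φ u = w μ := by
    intro μ
    by_cases hμ : μ ∈ leadSet V
    · obtain ⟨v, hv, hvμ⟩ := hμ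
      obtain ⟨_, ⟨u, rfl⟩, hx⟩ := (hw v hv μ hvμ).1
      exact ⟨u, fun _ => hx⟩
    · exact ⟨0, fun h => absurd h hμ⟩
  choose u hu using hu
  let K := (specSub ev (LinearMap.ker M.mulVecLin)).restrictScalars E
  let U := Submodule.span E ((fun μ => mapFam ev (u μ)) '' leadSet V)
  have hdiv : b ∈ powSat (ev c) (K ⊔ U) := by
    have : (⊤ : Submodule E (ι → MvPolynomial σ E)) ≤ powSat (ev c) (K ⊔ U) := by
      rw [← span_range_mapFam ev, Submodule.span_le]
      rintro _ ⟨v, rfl⟩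
      obtain ⟨N, hN⟩ := hw.exists_pow_smul_mem_span
        (mem_coordsSub.mpr (LinearMap.mem_range_self M.mulVecLin v))
      have himg : w '' leadSet V = φ '' (u '' leadSet V) := by
        rw [Set.image_image]
        exact Set.image_congr fun μ hμ => (hu μ hμ).symm
      rw [himg, Submodule.span_image] at hN
      obtain ⟨t, ht, htN⟩ := hN
      have hk : c ^ N • v - t ∈ LinearMap.ker M.mulVecLin := by
        have : φ (c ^ N • v - t) = 0 := by
          rw [map_sub, htN, map_smul]; exact sub_self _
        exact (coords σ r D).map_eq_zero_iff.mp this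
      refine ⟨N, ?_⟩
      have : ev c ^ N • mapFam ev v = mapFam ev (c ^ N • v - t) + mapFam ev t := by
        rw [← map_add, sub_add_cancel, map_smulₛₗ, map_pow]
      rw [this]
      refine Submodule.add_mem_sup (mapFam_mem_specSub ev hk) ?_
      have h2 : Submodule.span D (u '' leadSet V) ≤ U.comap (mapFam ev) := by
        rw [Submodule.span_le]
        rintro _ ⟨μ, hμ, rfl⟩
        exact Submodule.subset_span ⟨μ, hμ, rfl⟩
      exact h2 ht
    exact this trivial
  obtain ⟨N, hN⟩ := hdiv
  obtain ⟨k, hk, y, hy, hky⟩ := Submodule.mem_sup.mp hN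
  have hk0 : ψ k = 0 := by
    have : K ≤ LinearMap.ker ψ := by
      simp only [K]
      rw [restrictScalars_specSub, Submodule.span_le]
      rintro _ ⟨v, hv, rfl⟩
      have hv' : φ v = 0 := (coords σ r D).map_eq_zero_iff.mpr hv
      simp [hψ, hv']
    exact this hk
  have hb0 : ψ b = 0 := (coords σ r E).map_eq_zero_iff.mpr hb
  have hy0 : ψ y = 0 := by
    have := congrArg ψ hky
    rwa [map_add, map_smul, hb0, hk0, smul_zero, zero_add] at this
  obtain ⟨t, ht, hty⟩ := (Finsupp.mem_span_image_iff_linearCombination E).mp hy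
  have ht0 : t = 0 := by
    by_contra hne
    obtain ⟨μ, hμ, h⟩ := exists_linearCombination_apply_ne_zero
      (w := fun μ => mapCoords ev (w μ)) hne
      (fun μ hμ => hw.isLead_mapCoords hev (ht hμ))
    apply h
    have : Finsupp.linearCombination E (fun μ => mapCoords ev (w μ)) t = ψ y := by
      rw [← hty, Finsupp.linearCombination_apply, Finsupp.linearCombination_apply,
        Finsupp.sum, Finsupp.sum, map_sum]
      refine Finset.sum_congr rfl fun ν hν => ?_
      rw [map_smul, hψ, hu ν (ht hν)]
    rw [this, hy0, Finsupp.zero_apply]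
  rw [ht0, map_zero] at hty
  rw [← hty, add_zero] at hky
  have : b = (ev c ^ N)⁻¹ • k := by
    rw [hky, smul_smul, inv_mul_cancel₀ (pow_ne_zero _ hev), one_smul]
  rw [this]
  exact K.smul_mem _ hk

/-- A nonzerodivisor on the quotient by `U` generically specializes to a nonzerodivisor. -/
theorem exists_isRegular_specialization [IsNoetherianRing D]
    (U : Submodule (MvPolynomial σ D) (Fin r → MvPolynomial σ D)) (x : MvPolynomial σ D)
    (hx : ∀ y, x • y ∈ U → y ∈ U) :
    ∃ c : D, c ≠ 0 ∧ ∀ {E : Type} [Field E] (ev : D →+* E), ev c ≠ 0 →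
      ∀ y : Fin r → MvPolynomial σ E,
        MvPolynomial.map ev x • y ∈ specSub ev U → y ∈ specSub ev U := by
  classical
  obtain ⟨s, g, hg⟩ := Submodule.fg_iff_exists_fin_generating_family.mp
    (IsNoetherian.noetherian U)
  let G : Matrix (Fin r) (Fin s) (MvPolynomial σ D) := Matrix.of fun i j => g j i
  have hG : ∀ v, v ∈ U ↔ ∃ b, G.mulVec b = v := by
    intro v
    have : LinearMap.range G.mulVecLin = U := by
      rw [Matrix.range_mulVecLin, ← hg]; rfl
    rw [← this]; rfl
  obtain ⟨c, hc, H⟩ := exists_ker_specialization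
    (Matrix.fromCols (x • (1 : Matrix (Fin r) (Fin r) (MvPolynomial σ D))) G)
  refine ⟨c, hc, fun {E} _ ev hev y hy => ?_⟩
  have hle : specSub ev U ≤ LinearMap.range (G.map (MvPolynomial.map ev)).mulVecLin := by
    rw [specSub, Submodule.span_le]
    rintro _ ⟨v, hv, rfl⟩
    obtain ⟨b, rfl⟩ := (hG v).mp hv
    exact ⟨mapFam ev b, by rw [mapFam_mulVec]; rfl⟩
  obtain ⟨b, hb⟩ := hle hy
  rw [Matrix.mulVecLin_apply] at hb
  have hmap : (Matrix.fromCols (x • (1 : Matrix (Fin r) (Fin r) (MvPolynomial σ D))) G).map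
      (MvPolynomial.map ev) = Matrix.fromCols
        (MvPolynomial.map ev x • (1 : Matrix (Fin r) (Fin r) (MvPolynomial σ E)))
        (G.map (MvPolynomial.map ev)) := by
    ext1 i j
    rcases j with j | j
    · by_cases h : i = j
      · subst h; simp
      · simp [h]
    · simp
  have := H ev hev (Sum.elim y (-b)) (by
    rw [hmap, Matrix.fromCols_mulVec_sumElim, Matrix.mulVec_neg, hb, Matrix.smul_mulVec,
      Matrix.one_mulVec, add_neg_cancel])
  have hproj : specSub ev (LinearMap.ker (Matrix.fromCols
      (x • (1 : Matrix (Fin r) (Fin r) (MvPolynomial σ D))) G).mulVecLin) ≤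
      (specSub ev U).comap (LinearMap.funLeft (MvPolynomial σ E) (MvPolynomial σ E) Sum.inl) := by
    rw [specSub, Submodule.span_le]
    rintro _ ⟨v, hv, rfl⟩
    have hv' : x • (v ∘ Sum.inl) + G.mulVec (v ∘ Sum.inr) = 0 := by
      have h := hv
      rw [SetLike.mem_coe, LinearMap.mem_ker, Matrix.mulVecLin_apply,
        Matrix.fromCols_mulVec, Matrix.smul_mulVec, Matrix.one_mulVec] at h
      exact h
    have hv2 : v ∘ Sum.inl ∈ U := hx _ ((hG _).mpr ⟨-(v ∘ Sum.inr), by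
      rw [Matrix.mulVec_neg]; exact (eq_neg_of_add_eq_zero_left hv').symm⟩)
    exact mapFam_mem_specSub ev hv2
  exact hproj this

end Generic

section IdealVersions

variable {σ D E : Type*} [CommRing D]

/-- An ideal, as a submodule of the free module of rank one. -/
def idealVec (I : Ideal (MvPolynomial σ D)) :
    Submodule (MvPolynomial σ D) (Fin 1 → MvPolynomial σ D) :=
  Submodule.comap (LinearMap.proj 0) I

theorem mem_idealVec {I : Ideal (MvPolynomial σ D)} {v : Fin 1 → MvPolynomial σ D} :
    v ∈ idealVec I ↔ v 0 ∈ I := Iff.rfl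

theorem mem_specSub_idealVec [CommRing E] (ev : D →+* E) (I : Ideal (MvPolynomial σ D))
    (z : Fin 1 → MvPolynomial σ E) :
    z ∈ specSub ev (idealVec I) ↔ z 0 ∈ I.map (MvPolynomial.map ev) := by
  constructor
  · intro hz
    have hle : specSub ev (idealVec I) ≤
        Submodule.comap (LinearMap.proj 0) (I.map (MvPolynomial.map ev)) := by
      refine Submodule.span_le.mpr ?_
      rintro _ ⟨v, hv, rfl⟩
      exact Ideal.mem_map_of_mem _ hv
    exact hle hz
  · intro hz
    have hle : I.map (MvPolynomial.map ev) ≤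
        Submodule.comap (LinearMap.pi fun _ => LinearMap.id) (specSub ev (idealVec I)) := by
      refine Submodule.span_le.mpr ?_
      rintro _ ⟨a, ha, rfl⟩
      exact mapFam_mem_specSub ev (v := fun _ => a) (mem_idealVec.mpr ha)
    have h := hle hz
    have e : z = LinearMap.pi (fun _ => (LinearMap.id : _ →ₗ[MvPolynomial σ E] _)) (z 0) := by
      funext i; fin_cases i; rfl
    rw [e]; exact h

end IdealVersions

section IdealResults

variable {σ D : Type*} [LinearOrder σ] [Finite σ] [CommRing D] [IsDomain D]

theorem exists_isRegular_ideal [IsNoetherianRing D] (I : Ideal (MvPolynomial σ D))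
    (x : MvPolynomial σ D) (hx : ∀ y, x * y ∈ I → y ∈ I) :
    ∃ c : D, c ≠ 0 ∧ ∀ {E : Type} [Field E] (ev : D →+* E), ev c ≠ 0 →
      ∀ y : MvPolynomial σ E, MvPolynomial.map ev x * y ∈ I.map (MvPolynomial.map ev) →
        y ∈ I.map (MvPolynomial.map ev) := by
  obtain ⟨c, hc, h⟩ := exists_isRegular_specialization (idealVec I) x fun y hy => hx _ hy
  refine ⟨c, hc, fun {E} _ ev hev y hy => ?_⟩
  have := h ev hev (fun _ => y) ((mem_specSub_idealVec ev I _).mpr hy)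
  exact (mem_specSub_idealVec ev I _).mp this

theorem exists_torsion_bound_ideal (I : Ideal (MvPolynomial σ D)) :
    ∃ c : D, c ≠ 0 ∧ ∀ {E : Type} [CommRing E] [IsDomain E] (ev : D →+* E), ev c ≠ 0 →
      ∀ (w : E) (z : MvPolynomial σ E), w ≠ 0 → C w * z ∈ I.map (MvPolynomial.map ev) →
        ∃ N : ℕ, C (ev c) ^ N * z ∈ I.map (MvPolynomial.map ev) := by
  obtain ⟨c, hc, h⟩ := exists_torsion_bound (idealVec I)
  refine ⟨c, hc, fun {E} _ _ ev hev w z hw hz => ?_⟩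
  obtain ⟨N, hN⟩ := h ev hev w (fun _ => z) hw ((mem_specSub_idealVec ev I _).mpr (by
    simpa [MvPolynomial.smul_eq_C_mul] using hz))
  refine ⟨N, ?_⟩
  have := (mem_specSub_idealVec ev I _).mp hN
  simpa [MvPolynomial.smul_eq_C_mul] using this

end IdealResults

section Split

variable {σ : Type*} (s : Set σ)

open Classical in
/-- Polynomials in all variables, as polynomials in the variables outside `s` over the
polynomials in the variables of `s`. -/
def splitVars (D : Type*) [CommRing D] :
    MvPolynomial σ D →+* MvPolynomial {j // j ∉ s} (MvPolynomial s D) :=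
  eval₂Hom (C.comp C) fun i => if h : i ∈ s then C (X ⟨i, h⟩) else X ⟨i, h⟩

variable {D E : Type*} [CommRing D] [CommRing E]

theorem splitVars_C (d : D) : splitVars s D (C d) = C (C d) := by
  simp [splitVars]

theorem splitVars_X_of_mem {i : σ} (hi : i ∈ s) : splitVars s D (X i) = C (X ⟨i, hi⟩) := by
  simp [splitVars, hi]

theorem splitVars_X_of_notMem {i : σ} (hi : i ∉ s) : splitVars s D (X i) = X ⟨i, hi⟩ := by
  simp [splitVars, hi]

theorem splitVars_bijective (D : Type*) [CommRing D] :
    Function.Bijective (splitVars s D) := by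
  let g : MvPolynomial {j // j ∉ s} (MvPolynomial s D) →+* MvPolynomial σ D :=
    eval₂Hom (rename Subtype.val : MvPolynomial s D →ₐ[D] _).toRingHom fun i => X i.1
  have h1 : g.comp (splitVars s D) = RingHom.id _ := by
    refine MvPolynomial.ringHom_ext (fun d => ?_) fun i => ?_
    · simp [splitVars_C, g]
    · by_cases hi : i ∈ s
      · simp [splitVars_X_of_mem s hi, g]
      · simp [splitVars_X_of_notMem s hi, g]
  have h2 : (splitVars s D).comp g = RingHom.id _ := by
    refine MvPolynomial.ringHom_ext (fun q => ?_) fun i => ?_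
    · induction q using MvPolynomial.induction_on with
      | C a => simp [splitVars_C, g]
      | add p q hp hq => rw [map_add, map_add, hp, hq, map_add]
      | mul_X p i hp =>
        rw [map_mul, map_mul, hp, map_mul]
        simp [splitVars_X_of_mem s i.2, g]
    · simp [splitVars_X_of_notMem s i.2, g]
  exact Function.bijective_iff_has_inverse.mpr
    ⟨g, fun x => congrArg (· x) h1, fun x => congrArg (· x) h2⟩

theorem splitVars_rename (q : MvPolynomial s D) :
    splitVars s D (rename Subtype.val q) = C q := by
  induction q using MvPolynomial.induction_on with
  | C a => rw [rename_C, splitVars_C]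
  | add p q hp hq => rw [map_add, map_add, hp, hq, map_add]
  | mul_X p i hp => rw [map_mul, map_mul, hp, rename_X, splitVars_X_of_mem s i.2, map_mul]

theorem splitVars_map (ev : D →+* E) (q : MvPolynomial σ D) :
    splitVars s E (MvPolynomial.map ev q) =
      MvPolynomial.map (MvPolynomial.map ev) (splitVars s D q) := by
  induction q using MvPolynomial.induction_on with
  | C a => simp only [map_C, splitVars_C]
  | add p q hp hq => simp only [map_add, hp, hq]
  | mul_X p i hp =>
    simp only [map_mul, hp, map_X]
    by_cases hi : i ∈ s
    · simp only [splitVars_X_of_mem s hi, map_C, map_X]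
    · simp only [splitVars_X_of_notMem s hi, map_X]

end Split

section Independent

variable {σ : Type} [LinearOrder σ] [Finite σ] {D : Type*} [CommRing D] [IsDomain D]
  [IsNoetherianRing D]

theorem exists_torsionFree_specialization (P : Ideal (MvPolynomial σ D)) [P.IsPrime] (s : Set σ)
    (hs : ∀ q : MvPolynomial s D, rename Subtype.val q ∈ P → q = 0) :
    ∃ c : D, c ≠ 0 ∧ ∀ {κ : Type} [Field κ] (ev : D →+* κ), ev c ≠ 0 →
      ∀ (w : MvPolynomial s κ) (z : MvPolynomial σ κ), w ≠ 0 →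
        rename Subtype.val w * z ∈ P.map (MvPolynomial.map ev) → z ∈ P.map (MvPolynomial.map ev) := by
  obtain ⟨g, hg, h⟩ := exists_torsion_bound_ideal (P.map (splitVars s D))
  obtain ⟨μ, hμ⟩ := MvPolynomial.ne_zero_iff.mp hg
  obtain ⟨c, hc, hreg⟩ := exists_isRegular_ideal P (rename Subtype.val g) fun y hy =>
    (Ideal.IsPrime.mem_or_mem ‹P.IsPrime› hy).resolve_left fun h0 => hg (hs g h0)
  refine ⟨c * g.coeff μ, mul_ne_zero hc hμ, fun {κ} _ ev hev w z hw hz => ?_⟩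
  rw [map_mul] at hev
  have hev1 := left_ne_zero_of_mul hev
  have hev2 : MvPolynomial.map ev g ≠ 0 := fun h0 => right_ne_zero_of_mul hev (by
    rw [← coeff_map, h0, coeff_zero])
  have hmap : (P.map (splitVars s D)).map (MvPolynomial.map (MvPolynomial.map ev)) =
      (P.map (MvPolynomial.map ev)).map (splitVars s κ) := by
    rw [Ideal.map_map, Ideal.map_map]
    exact congrArg (fun f => P.map f) (RingHom.ext fun q => (splitVars_map s ev q).symm)
  have hmem : ∀ y, splitVars s κ y ∈ (P.map (MvPolynomial.map ev)).map (splitVars s κ) ↔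
      y ∈ P.map (MvPolynomial.map ev) := fun y => by
    rw [← Ideal.mem_comap, Ideal.comap_map_of_bijective _ (splitVars_bijective s κ)]
  obtain ⟨N, hN⟩ := h (MvPolynomial.map ev) hev2 w (splitVars s κ z) hw (by
    rw [hmap, ← splitVars_rename, ← map_mul, hmem]; exact hz)
  rw [hmap, ← splitVars_rename, ← map_pow, ← map_mul, hmem] at hN
  clear hz hw
  induction N with
  | zero => simpa using hN
  | succ N ih =>
    refine ih (hreg ev hev1 _ ?_)
    rwa [map_rename, ← mul_assoc, ← pow_succ']

theorem Ideal.le_of_independent_variables {σ κ : Type*} [Field κ] {𝔭 𝔮 : Ideal (MvPolynomial σ κ)}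
    [𝔭.IsPrime] (hle : 𝔭 ≤ 𝔮) (s : Set σ)
    (hs : ∀ w : MvPolynomial s κ, rename Subtype.val w ∈ 𝔮 → w = 0)
    (hmax : ∀ j ∉ s, ∃ q : MvPolynomial (insert j s : Set σ) κ, q ≠ 0 ∧
      rename Subtype.val q ∈ 𝔭) : 𝔮 ≤ 𝔭 := by
  classical
  let x : σ → MvPolynomial σ κ ⧸ 𝔭 := fun i => Ideal.Quotient.mk 𝔭 (X i)
  have hx : ∀ (t : Set σ) (w : MvPolynomial t κ),
      aeval (fun i : t => x i) w = Ideal.Quotient.mk 𝔭 (rename Subtype.val w) := fun t w => by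
    have : (aeval fun i : t => x i) =
        (Ideal.Quotient.mkₐ κ 𝔭).comp (rename (R := κ) (Subtype.val : t → σ)) := by
      ext i; simp [x]
    rw [this]; rfl
  have hind : AlgebraicIndepOn κ x s := by
    refine algebraicIndependent_iff.mpr fun w hw => hs w (hle ?_)
    rwa [hx, Ideal.Quotient.eq_zero_iff_mem] at hw
  let B := Algebra.adjoin κ (x '' s)
  have halg : ∀ y : MvPolynomial σ κ ⧸ 𝔭, IsAlgebraic B y := by
    intro y
    obtain ⟨p, rfl⟩ := Ideal.Quotient.mk_surjective y
    induction p using MvPolynomial.induction_on with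
    | C a =>
      exact isAlgebraic_algebraMap (R := B) (algebraMap κ B a)
    | add p q hp hq => rw [map_add]; exact hp.add hq
    | mul_X p j hp =>
      rw [map_mul]
      refine hp.mul ?_
      by_cases hj : j ∈ s
      · exact isAlgebraic_algebraMap (R := B) ⟨_, Algebra.subset_adjoin ⟨j, hj, rfl⟩⟩
      · by_contra htr
        obtain ⟨q, hq0, hq⟩ := hmax j hj
        have h := (AlgebraicIndepOn.insert_iff (x := x) hj).mpr ⟨hind, htr⟩
        exact hq0 (algebraicIndependent_iff.mp h q (by
          rw [hx, Ideal.Quotient.eq_zero_iff_mem]; exact hq))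
  intro y hy
  by_contra hy0
  have hne : Ideal.comap (algebraMap B (MvPolynomial σ κ ⧸ 𝔭)) (𝔮.map (Ideal.Quotient.mk 𝔭)) ≠ ⊥ :=
    Ideal.comap_ne_bot_of_algebraic_mem (x := Ideal.Quotient.mk 𝔭 y)
      (by rwa [Ne, Ideal.Quotient.eq_zero_iff_mem]) (Ideal.mem_map_of_mem _ hy) (halg _)
  obtain ⟨b, hb, hb0⟩ := Submodule.exists_mem_ne_zero_of_ne_bot hne
  obtain ⟨w, hw⟩ : ∃ w : MvPolynomial s κ, aeval (fun i : s => x i) w = b.1 := by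
    have := b.2
    simp only [B, Set.image_eq_range, Algebra.adjoin_range_eq_range_aeval] at this
    exact this
  have hb' : b.1 ∈ 𝔮.map (Ideal.Quotient.mk 𝔭) := hb
  rw [← hw, hx, Ideal.mem_quotient_iff_mem hle] at hb'
  have hw0 := hs w hb'
  exact hb0 (Subtype.ext (by rw [← hw, hw0, map_zero]; rfl))

theorem mul_mem_of_isAssociatedPrime {T : Type*} [CommRing T] [IsNoetherianRing T] {I 𝔮 : Ideal T}
    (h : IsAssociatedPrime 𝔮 (T ⧸ I)) : ∃ z ∉ I, ∀ a, a ∈ 𝔮 ↔ a * z ∈ I := by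
  obtain ⟨hp, x, hx⟩ := isAssociatedPrime_iff.mp h
  obtain ⟨z, rfl⟩ := Ideal.Quotient.mk_surjective x
  have hmem : ∀ a, a ∈ 𝔮 ↔ a * z ∈ I := fun a => by
    rw [hx, Submodule.mem_colon_singleton, Submodule.mem_bot, ← Ideal.Quotient.eq_zero_iff_mem,
      map_mul]
    rfl
  exact ⟨z, fun hz => hp.ne_top ((Ideal.eq_top_iff_one _).mpr ((hmem 1).mpr (by simpa using hz))),
    hmem⟩

theorem exists_minimal_specialization (P : Ideal (MvPolynomial σ D)) [P.IsPrime]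
    (hP : ∀ d : D, C d ∈ P → d = 0) :
    ∃ c : D, c ≠ 0 ∧ ∀ {κ : Type} [Field κ] (ev : D →+* κ), ev c ≠ 0 →
      ∀ 𝔮 : Ideal (MvPolynomial σ κ),
        IsAssociatedPrime 𝔮 (MvPolynomial σ κ ⧸ P.map (MvPolynomial.map ev)) →
        𝔮 ∈ (P.map (MvPolynomial.map ev)).minimalPrimes := by
  classical
  have := Fintype.ofFinite σ
  obtain ⟨s, -, hs⟩ := Finite.exists_le_maximal
    (p := fun s : Set σ => ∀ q : MvPolynomial s D, rename Subtype.val q ∈ P → q = 0) (a := ∅)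
    (fun q hq => by
      obtain ⟨d, rfl⟩ := C_surjective _ q
      rw [rename_C] at hq
      rw [hP d hq, map_zero])
  obtain ⟨c, hc, hfree⟩ := exists_torsionFree_specialization P s hs.prop
  have hj : ∀ j : σ, ∃ d : D, d ≠ 0 ∧ (j ∉ s → ∃ q : MvPolynomial (insert j s : Set σ) D,
      (∃ μ, q.coeff μ = d) ∧ rename Subtype.val q ∈ P) := by
    intro j
    by_cases hjs : j ∈ s
    · exact ⟨1, one_ne_zero, fun h => absurd hjs h⟩
    · have := hs.not_prop_of_gt (Set.ssubset_insert hjs)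
      push Not at this
      obtain ⟨q, hq, hq0⟩ := this
      obtain ⟨μ, hμ⟩ := MvPolynomial.ne_zero_iff.mp hq0
      exact ⟨_, hμ, fun _ => ⟨q, ⟨μ, rfl⟩, hq⟩⟩
  choose d hd0 hd using hj
  refine ⟨c * ∏ j, d j, mul_ne_zero hc (Finset.prod_ne_zero_iff.mpr fun j _ => hd0 j),
    fun {κ} _ ev hev 𝔮 h𝔮 => ?_⟩
  rw [map_mul, map_prod] at hev
  obtain ⟨z, hz, hmem⟩ := mul_mem_of_isAssociatedPrime h𝔮
  have hle : P.map (MvPolynomial.map ev) ≤ 𝔮 := fun a ha => (hmem a).mpr (Ideal.mul_mem_right _ _ ha)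
  refine ⟨⟨h𝔮.isPrime, hle⟩, fun 𝔭 h𝔭 h𝔭𝔮 => ?_⟩
  have := h𝔭.1
  refine Ideal.le_of_independent_variables h𝔭𝔮 s (fun w hw => ?_) fun j hj => ?_
  · by_contra hw0
    exact hz (hfree ev (left_ne_zero_of_mul hev) w z hw0 ((hmem _).mp hw))
  · obtain ⟨q, ⟨μ, hμ⟩, hq⟩ := hd j hj
    refine ⟨MvPolynomial.map ev q, fun h0 => ?_, h𝔭.2 ?_⟩
    · refine Finset.prod_ne_zero_iff.mp (right_ne_zero_of_mul hev) j (Finset.mem_univ _) ?_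
      rw [← hμ, ← coeff_map, h0, coeff_zero]
    · rw [← map_rename]; exact Ideal.mem_map_of_mem _ hq

end Independent

theorem le_annihilator_quotient_iff {S M : Type*} [CommRing S] [AddCommGroup M] [Module S M]
    {I J : Ideal S} :
    I ≤ Module.annihilator S (M ⧸ J • (⊤ : Submodule S M)) ↔
      I • (⊤ : Submodule S M) ≤ J • ⊤ := by
  rw [Submodule.smul_le]
  constructor
  · intro h r hr x _
    have := Module.mem_annihilator.mp (h hr) (Submodule.Quotient.mk x)
    rwa [← Submodule.Quotient.mk_smul, Submodule.Quotient.mk_eq_zero] at this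
  · intro h r hr
    rw [Module.mem_annihilator]
    intro x
    obtain ⟨x, rfl⟩ := Submodule.Quotient.mk_surjective _ x
    rw [← Submodule.Quotient.mk_smul, Submodule.Quotient.mk_eq_zero]
    exact h r hr x trivial

section Depth

variable {S : Type} [CommRing S] [IsNoetherianRing S] [IsLocalRing S] {M : Type} [AddCommGroup M]
  [Module S M] [Module.Finite S M]

open IsLocalRing

theorem supportDim_eq_zero_iff :
    Module.supportDim S M = 0 ↔ Nontrivial M ∧ ∃ N : ℕ,
      maximalIdeal S ^ N ≤ Module.annihilator S M := by
  constructor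
  · intro h
    have h1 : Nontrivial M := by
      rw [← Module.supportDim_ne_bot_iff_nontrivial S, h]; exact WithBot.zero_ne_bot
    refine ⟨h1, ?_⟩
    have h2 := support_of_supportDim_eq_zero S M h
    rw [Module.support_eq_zeroLocus] at h2
    have h3 := (PrimeSpectrum.zeroLocus_subset_zeroLocus_iff _ _).mp h2.le
    exact Ideal.exists_pow_le_of_le_radical_of_fg h3 (IsNoetherian.noetherian _)
  · rintro ⟨h1, N, hN⟩
    have hs : ∀ p ∈ Module.support S M, p = closedPoint S := fun p hp => by
      rw [Module.support_eq_zeroLocus, PrimeSpectrum.mem_zeroLocus] at hp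
      have h2 : maximalIdeal S ≤ p.asIdeal :=
        Ideal.IsPrime.le_of_pow_le (hN.trans hp)
      exact PrimeSpectrum.ext ((maximalIdeal.isMaximal S).eq_of_le p.2.ne_top h2).symm
    have : Subsingleton (Module.support S M) := ⟨fun a b => Subtype.ext <| by
      rw [hs a a.2, hs b b.2]⟩
    refine le_antisymm Order.krullDim_nonpos_of_subsingleton ?_
    have : Nonempty (Module.support S M) := Module.nonempty_support_of_nontrivial.to_subtype
    exact Order.krullDim_nonneg

theorem depth_le_supportDim [Nontrivial M] :
    (depth S M : WithBot ℕ∞) ≤ Module.supportDim S M := by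
  obtain ⟨d, hd⟩ := WithBot.ne_bot_iff_exists.mp (Module.supportDim_ne_bot_of_nontrivial S M)
  rw [← hd, WithBot.coe_le_coe]
  refine sSup_le ?_
  rintro _ ⟨t, rfl, rs, rfl, hrs, hreg⟩
  rw [← WithBot.coe_le_coe, hd]
  have := Module.supportDim_add_length_eq_supportDim_of_isRegular rs hreg
  have h1 : Nontrivial (M ⧸ Ideal.ofList rs • (⊤ : Submodule S M)) :=
    hreg.quot_ofList_smul_nontrivial ⊤
  obtain ⟨d', hd'⟩ := WithBot.ne_bot_iff_exists.mp
    (Module.supportDim_ne_bot_of_nontrivial S (M ⧸ Ideal.ofList rs • (⊤ : Submodule S M)))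
  rw [← this, ← hd']
  norm_cast
  exact le_add_self

theorem depth_eq_moduleDim [Nontrivial M] {rs : List S} (hrs : ∀ x ∈ rs, x ∈ maximalIdeal S)
    (hreg : RingTheory.Sequence.IsWeaklyRegular M rs) {N : ℕ}
    (hN : maximalIdeal S ^ N • (⊤ : Submodule S M) ≤ Ideal.ofList rs • ⊤) :
    (depth S M : WithBot ℕ∞) = moduleDim S M := by
  have hreg' := RingTheory.Sequence.IsRegular.of_isWeaklyRegular_of_mem_maximalIdeal M hrs hreg
  rw [moduleDim, ← Module.supportDim_eq_ringKrullDim_quotient_annihilator]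
  refine le_antisymm depth_le_supportDim ?_
  have h0 : Module.supportDim S (M ⧸ Ideal.ofList rs • (⊤ : Submodule S M)) = 0 :=
    supportDim_eq_zero_iff.mpr ⟨hreg'.quot_ofList_smul_nontrivial ⊤, N,
      le_annihilator_quotient_iff.mpr hN⟩
  rw [← Module.supportDim_add_length_eq_supportDim_of_isRegular rs hreg', h0, zero_add]
  have : ((rs.length : ℕ∞) : WithBot ℕ∞) ≤ (depth S M : WithBot ℕ∞) :=
    WithBot.coe_le_coe.mpr (le_sSup ⟨rs.length, rfl, rs, rfl, hrs, hreg'⟩)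
  exact_mod_cast this

theorem exists_isRegular_of_depth_eq (h : (depth S M : WithBot ℕ∞) = moduleDim S M) :
    Nontrivial M ∧ ∃ rs : List S, (∀ x ∈ rs, x ∈ maximalIdeal S) ∧
      RingTheory.Sequence.IsWeaklyRegular M rs ∧ ∃ N : ℕ,
      maximalIdeal S ^ N • (⊤ : Submodule S M) ≤ Ideal.ofList rs • ⊤ := by
  rw [moduleDim, ← Module.supportDim_eq_ringKrullDim_quotient_annihilator] at h
  have hM : Nontrivial M := by
    rw [← Module.supportDim_ne_bot_iff_nontrivial S, ← h]; exact WithBot.coe_ne_bot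
  refine ⟨hM, ?_⟩
  have hlt : depth S M < ⊤ := by
    rw [← WithBot.coe_lt_coe, h]
    exact (Module.supportDim_le_ringKrullDim S M).trans_lt ringKrullDim_lt_top
  have hne : Nonempty {t : ℕ∞ | ∃ t' : ℕ, t = (t' : ℕ∞) ∧ GradeGE (maximalIdeal S) M t'} :=
    ⟨0, 0, rfl, [], rfl, by simp, RingTheory.Sequence.IsRegular.nil S M⟩
  obtain ⟨t, ht, rs, hl, hrs, hreg⟩ := ENat.sSup_mem_of_nonempty_of_lt_top hlt
  refine ⟨rs, hrs, hreg.1, ?_⟩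
  have h1 := Module.supportDim_add_length_eq_supportDim_of_isRegular rs hreg
  have h2 : Module.supportDim S (M ⧸ Ideal.ofList rs • (⊤ : Submodule S M)) = 0 := by
    rw [← h] at h1
    have ht' : depth S M = (t : ℕ∞) := ht
    rw [ht', hl] at h1
    have h3 : Nontrivial (M ⧸ Ideal.ofList rs • (⊤ : Submodule S M)) :=
      hreg.quot_ofList_smul_nontrivial ⊤
    obtain ⟨d', hd'⟩ := WithBot.ne_bot_iff_exists.mp
      (Module.supportDim_ne_bot_of_nontrivial S (M ⧸ Ideal.ofList rs • (⊤ : Submodule S M)))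
    rw [← hd'] at h1 ⊢
    norm_cast at h1 ⊢
    have : d' ≠ ⊤ := by rintro rfl; simp at h1
    lift d' to ℕ using this
    norm_cast at h1 ⊢
    omega
  obtain ⟨-, N, hN⟩ := supportDim_eq_zero_iff.mp h2
  exact ⟨N, le_annihilator_quotient_iff.mp hN⟩

end Depth

section Loc

variable {T S : Type*} [CommRing T] [CommRing S] [Algebra T S] {r s : ℕ}

/-- The submodule `im B + I F` of a free module `F`. -/
def relSub (B : Matrix (Fin r) (Fin s) T) (I : Ideal T) : Submodule T (Fin r → T) :=
  LinearMap.range B.mulVecLin ⊔ I • ⊤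

theorem mulVec_mem_relSub (B : Matrix (Fin r) (Fin s) T) (I : Ideal T) (b : Fin s → T) :
    B.mulVec b ∈ relSub B I :=
  Submodule.mem_sup_left ⟨b, rfl⟩

theorem smul_mem_relSub (B : Matrix (Fin r) (Fin s) T) {I : Ideal T} {a : T} (ha : a ∈ I)
    (v : Fin r → T) : a • v ∈ relSub B I :=
  Submodule.mem_sup_right (Submodule.smul_mem_smul ha trivial)

theorem relSub_le {B : Matrix (Fin r) (Fin s) T} {I : Ideal T} {W : Submodule T (Fin r → T)} :
    relSub B I ≤ W ↔ (∀ b, B.mulVec b ∈ W) ∧ ∀ a ∈ I, ∀ v : Fin r → T, a • v ∈ W := by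
  rw [relSub, sup_le_iff, Submodule.smul_le]
  refine and_congr ⟨fun h b => h ⟨b, rfl⟩, ?_⟩ ⟨fun h a ha v => h a ha v trivial,
    fun h a ha v _ => h a ha v⟩
  rintro h _ ⟨b, rfl⟩
  exact h b

/-- The entrywise localization map of free modules. -/
def locVec (T S : Type*) [CommRing T] [CommRing S] [Algebra T S] (r : ℕ) :
    (Fin r → T) →ₗ[T] (Fin r → S) :=
  LinearMap.compLeft (Algebra.linearMap T S) (Fin r)

theorem locVec_apply (v : Fin r → T) (i : Fin r) : locVec T S r v i = algebraMap T S (v i) := rfl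

theorem locVec_mulVec (A : Matrix (Fin r) (Fin s) T) (b : Fin s → T) :
    locVec T S r (A.mulVec b) = (A.map (algebraMap T S)).mulVec (locVec T S s b) := by
  ext i
  simp [locVec_apply, Matrix.mulVec, dotProduct]

theorem locVec_smul (a : T) (v : Fin r → T) :
    locVec T S r (a • v) = algebraMap T S a • locVec T S r v := by
  rw [map_smul, algebraMap_smul]

theorem exists_smul_eq_locVec (M : Submonoid T) [IsLocalization M S] (y : Fin r → S) :
    ∃ g ∈ M, ∃ v, algebraMap T S g • y = locVec T S r v := by
  obtain ⟨g, hg⟩ := IsLocalization.exist_integer_multiples_of_finite M y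
  choose v hv using hg
  refine ⟨g, g.2, v, funext fun i => ?_⟩
  rw [locVec_apply, hv, Pi.smul_apply, smul_eq_mul, Algebra.smul_def]

theorem locVec_mem_relSub_iff (M : Submonoid T) [IsLocalization M S]
    {A : Matrix (Fin r) (Fin s) T} {B : Matrix (Fin r) (Fin s) S} {h : T} (hM : h ∈ M)
    (hAB : ∀ i j, algebraMap T S h * B i j = algebraMap T S (A i j)) (I : Ideal T)
    (t : Fin r → T) :
    locVec T S r t ∈ relSub B (I.map (algebraMap T S)) ↔ ∃ g ∈ M, g • t ∈ relSub A I := by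
  have hAB' : A.map (algebraMap T S) = algebraMap T S h • B := by
    ext i j; simp [hAB]
  have hu : ∀ g ∈ M, IsUnit (algebraMap T S g) := fun g hg => IsLocalization.map_units S ⟨g, hg⟩
  have hunit : ∀ (W : Submodule S (Fin r → S)) (g : T) (y : Fin r → S), g ∈ M →
      (algebraMap T S g • y ∈ W ↔ y ∈ W) := fun W g y hg => W.smul_mem_iff_of_isUnit (hu g hg)
  constructor
  · intro ht
    let W : Submodule S (Fin r → S) :=
      { carrier := { y | ∃ g ∈ M, ∃ v ∈ relSub A I, algebraMap T S g • y = locVec T S r v }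
        zero_mem' := ⟨1, M.one_mem, 0, Submodule.zero_mem _, by simp⟩
        add_mem' := by
          rintro y y' ⟨g, hg, v, hv, e⟩ ⟨g', hg', v', hv', e'⟩
          refine ⟨g' * g, M.mul_mem hg' hg, g' • v + g • v',
            Submodule.add_mem _ (Submodule.smul_mem _ _ hv) (Submodule.smul_mem _ _ hv'), ?_⟩
          rw [map_add, locVec_smul, locVec_smul, ← e, ← e', map_mul, smul_add, smul_smul, smul_smul,
            mul_comm (algebraMap T S g)]
        smul_mem' := by
          rintro a y ⟨g, hg, v, hv, e⟩
          obtain ⟨⟨f, q⟩, hq⟩ := IsLocalization.surj M a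
          refine ⟨q * g, M.mul_mem q.2 hg, f • v, Submodule.smul_mem _ _ hv, ?_⟩
          rw [locVec_smul, ← e, ← hq, map_mul, smul_smul, smul_smul]
          congr 1; ring }
    have hle : relSub B (I.map (algebraMap T S)) ≤ W := by
      refine relSub_le.mpr ⟨fun b => ?_, fun a ha v => ?_⟩
      · obtain ⟨g, hg, v, e⟩ := exists_smul_eq_locVec M b
        refine ⟨h * g, M.mul_mem hM hg, A.mulVec v, mulVec_mem_relSub _ _ _, ?_⟩
        rw [locVec_mulVec, ← e, hAB', Matrix.smul_mulVec, Matrix.mulVec_smul, smul_smul, map_mul]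
      · obtain ⟨g, hg, w, e⟩ := exists_smul_eq_locVec M v
        rw [← hunit W g _ hg, smul_comm, e]
        have : I.map (algebraMap T S) ≤ Submodule.comap (LinearMap.toSpanSingleton S _
            (locVec T S r w)) W := by
          refine Ideal.map_le_iff_le_comap.mpr fun p hp => ?_
          exact ⟨1, M.one_mem, p • w, smul_mem_relSub _ hp _, by
            rw [map_one, one_smul, locVec_smul]; rfl⟩
        exact this ha
    obtain ⟨g, hg, v, hv, e⟩ := hle ht
    rw [← locVec_smul] at e
    choose c hc using fun i => IsLocalization.exists_of_eq (M := M) (congrFun e i)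
    refine ⟨(∏ i, (c i : T)) * g, M.mul_mem (Submonoid.prod_mem _ fun i _ => (c i).2) hg, ?_⟩
    have : ((∏ i, (c i : T)) * g) • t = (∏ i, (c i : T)) • v := by
      rw [mul_smul]
      funext i
      have hi : (c i : T) * (g * t i) = c i * v i := hc i
      simp only [Pi.smul_apply, smul_eq_mul]
      rw [← Finset.prod_erase_mul _ _ (Finset.mem_univ i), mul_assoc, hi, mul_assoc]
    rw [this]
    exact Submodule.smul_mem _ _ hv
  · rintro ⟨g, hg, hgt⟩
    rw [← hunit _ g _ hg, ← locVec_smul]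
    have hle : relSub A I ≤ Submodule.comap (locVec T S r)
        ((relSub B (I.map (algebraMap T S))).restrictScalars T) := by
      refine relSub_le.mpr ⟨fun b => ?_, fun a ha v => ?_⟩
      · rw [Submodule.mem_comap, locVec_mulVec, hAB', Matrix.smul_mulVec]
        exact Submodule.smul_mem _ _ (mulVec_mem_relSub _ _ _)
      · rw [Submodule.mem_comap, locVec_smul]
        exact smul_mem_relSub _ (Ideal.mem_map_of_mem _ ha) _
    exact hle hgt

theorem apply_mem_smul_top_iff {F L : Type*} [AddCommGroup F] [Module T F] [AddCommGroup L]
    [Module T L] {π : F →ₗ[T] L} (hπ : Function.Surjective π) (I : Ideal T) (y : F) :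
    π y ∈ I • (⊤ : Submodule T L) ↔ y ∈ LinearMap.ker π ⊔ I • ⊤ := by
  have h1 : I • (⊤ : Submodule T L) = (I • (⊤ : Submodule T F)).map π := by
    rw [Submodule.map_smul'', Submodule.map_top, LinearMap.range_eq_top.mpr hπ]
  rw [h1, ← Submodule.mem_comap, Submodule.comap_map_eq, sup_comm]

theorem isSMulRegular_quotient_iff {F L : Type*} [AddCommGroup F] [Module T F] [AddCommGroup L]
    [Module T L] {π : F →ₗ[T] L} (hπ : Function.Surjective π) (I : Ideal T) (a : T) :
    IsSMulRegular (L ⧸ I • (⊤ : Submodule T L)) a ↔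
      ∀ y : F, a • y ∈ LinearMap.ker π ⊔ I • ⊤ → y ∈ LinearMap.ker π ⊔ I • ⊤ := by
  rw [isSMulRegular_quotient_iff_mem_of_smul_mem]
  simp only [← apply_mem_smul_top_iff hπ, map_smul]
  exact ⟨fun h y => h (π y), fun h x hx => by
    obtain ⟨y, rfl⟩ := hπ x
    exact h y hx⟩

end Loc

section Sat

variable {T S : Type*} [CommRing T] [CommRing S] [Algebra T S] {r s : ℕ}

/-- The elements that some element of `M` multiplies into `W`. -/
def satSub (M : Submonoid T) (W : Submodule T (Fin r → T)) : Submodule T (Fin r → T) where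
  carrier := { t | ∃ g ∈ M, g • t ∈ W }
  zero_mem' := ⟨1, M.one_mem, by simp⟩
  add_mem' := by
    rintro x y ⟨g, hg, h⟩ ⟨g', hg', h'⟩
    refine ⟨g * g', M.mul_mem hg hg', ?_⟩
    rw [smul_add, mul_smul g g' y, mul_comm, mul_smul g' g x]
    exact W.add_mem (W.smul_mem _ h) (W.smul_mem _ h')
  smul_mem' := by
    rintro a x ⟨g, hg, h⟩
    exact ⟨g, hg, by rw [smul_comm]; exact W.smul_mem _ h⟩

theorem mem_satSub {M : Submonoid T} {W : Submodule T (Fin r → T)} {t : Fin r → T} :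
    t ∈ satSub M W ↔ ∃ g ∈ M, g • t ∈ W := Iff.rfl

theorem le_satSub (M : Submonoid T) (W : Submodule T (Fin r → T)) : W ≤ satSub M W :=
  fun t ht => ⟨1, M.one_mem, by rwa [one_smul]⟩

theorem exists_smul_mem_of_satSub [IsNoetherianRing T] (M : Submonoid T)
    (W : Submodule T (Fin r → T)) : ∃ g ∈ M, ∀ t ∈ satSub M W, g • t ∈ W := by
  classical
  obtain ⟨G, hG⟩ := IsNoetherian.noetherian (satSub M W)
  have hmem : ∀ t : G, ∃ g ∈ M, g • (t : Fin r → T) ∈ W := fun t =>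
    mem_satSub.mp (hG ▸ Submodule.subset_span t.2)
  choose g hgM hg using hmem
  refine ⟨∏ t, g t, Submonoid.prod_mem _ fun t _ => hgM t, fun t ht => ?_⟩
  have hle : satSub M W ≤ W.comap (LinearMap.lsmul T _ (∏ t, g t)) := by
    rw [← hG]
    refine Submodule.span_le.mpr fun t ht => ?_
    have : (∏ t, g t) • t ∈ W := by
      rw [← Finset.prod_erase_mul _ _ (Finset.mem_univ (⟨t, ht⟩ : G)), mul_smul]
      exact W.smul_mem _ (hg ⟨t, ht⟩)
    exact this
  exact hle ht

section Presentation

variable (M : Submonoid T) [IsLocalization M S] {L : Type*} [AddCommGroup L] [Module S L]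
  {A : Matrix (Fin r) (Fin s) T} {B : Matrix (Fin r) (Fin s) S} {h : T} (hM : h ∈ M)
  (hAB : ∀ i j, algebraMap T S h * B i j = algebraMap T S (A i j))
  {π : (Fin r → S) →ₗ[S] L} (hπ : Function.Surjective π)
  (hker : LinearMap.ker π = LinearMap.range B.mulVecLin)

include hM hAB hπ hker

theorem isWeaklyRegular_map_iff (xs : List T) :
    RingTheory.Sequence.IsWeaklyRegular L (xs.map (algebraMap T S)) ↔
      ∀ (i : ℕ) (hi : i < xs.length) (t : Fin r → T),
        xs[i] • t ∈ satSub M (relSub A (Ideal.ofList (xs.take i))) →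
        t ∈ satSub M (relSub A (Ideal.ofList (xs.take i))) := by
  rw [RingTheory.Sequence.isWeaklyRegular_iff]
  simp only [List.length_map, List.getElem_map]
  refine forall₂_congr fun i hi => ?_
  rw [← List.map_take, ← Ideal.map_ofList, isSMulRegular_quotient_iff hπ, hker]
  change (∀ y, _ ∈ relSub B _ → _ ∈ relSub B _) ↔ _
  simp only [mem_satSub, ← locVec_mem_relSub_iff M hM hAB]
  constructor
  · intro H t ht
    exact H _ (by rwa [locVec_smul] at ht)
  · intro H y hy
    obtain ⟨g, hg, v, e⟩ := exists_smul_eq_locVec M y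
    have hu : IsUnit (algebraMap T S g) := IsLocalization.map_units S ⟨g, hg⟩
    rw [← Submodule.smul_mem_iff_of_isUnit _ hu, e]
    refine H v ?_
    rw [locVec_smul, ← e, smul_comm]
    exact Submodule.smul_mem _ _ hy

theorem smul_top_le_ofList_map_iff (J : Ideal T) (xs : List T) :
    J.map (algebraMap T S) • (⊤ : Submodule S L) ≤ Ideal.ofList (xs.map (algebraMap T S)) • ⊤ ↔
      ∀ a ∈ J, ∀ t : Fin r → T, a • t ∈ satSub M (relSub A (Ideal.ofList xs)) := by
  simp only [← Ideal.map_ofList, mem_satSub, ← locVec_mem_relSub_iff M hM hAB]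
  have key : ∀ y, y ∈ relSub B ((Ideal.ofList xs).map (algebraMap T S)) ↔
      π y ∈ (Ideal.ofList xs).map (algebraMap T S) • (⊤ : Submodule S L) := fun y => by
    rw [apply_mem_smul_top_iff hπ, hker]; rfl
  constructor
  · intro H a ha t
    rw [key, locVec_smul, map_smul]
    exact H (Submodule.smul_mem_smul (Ideal.mem_map_of_mem _ ha) trivial)
  · intro H
    refine Submodule.smul_le.mpr fun a ha x _ => ?_
    obtain ⟨y, rfl⟩ := hπ x
    have hle : J.map (algebraMap T S) ≤ Submodule.comap (LinearMap.toSpanSingleton S _ (π y))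
        ((Ideal.ofList xs).map (algebraMap T S) • (⊤ : Submodule S L)) := by
      refine Ideal.map_le_iff_le_comap.mpr fun p hp => ?_
      change algebraMap T S p • π y ∈
        (Ideal.ofList xs).map (algebraMap T S) • (⊤ : Submodule S L)
      obtain ⟨g, hg, v, e⟩ := exists_smul_eq_locVec M y
      have hu : IsUnit (algebraMap T S g) := IsLocalization.map_units S ⟨g, hg⟩
      rw [← Submodule.smul_mem_iff_of_isUnit _ hu, smul_comm, ← map_smul, e, ← map_smul,
        ← locVec_smul, ← key]
      exact H p hp v
    exact hle ha

end Presentation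

section Nontrivial

variable (P : Ideal T) [P.IsPrime] [IsLocalization.AtPrime S P] {L : Type*} [AddCommGroup L]
  [Module S L] {A : Matrix (Fin r) (Fin s) T} {B : Matrix (Fin r) (Fin s) S} {h : T}
  (hAB : ∀ i j, algebraMap T S h * B i j = algebraMap T S (A i j))
  {π : (Fin r → S) →ₗ[S] L} (hker : LinearMap.ker π = LinearMap.range B.mulVecLin)

include hAB hker

theorem exists_vecMul_mem_of_nontrivial (hπ : Function.Surjective π) [Nontrivial L] :
    ∃ (v : Fin r → T) (j : Fin r), v j ∉ P ∧ ∀ i, (Matrix.vecMul v A) i ∈ P := by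
  classical
  have : IsLocalRing S := IsLocalization.AtPrime.isLocalRing S P
  have : Module.Finite S L := Module.Finite.of_surjective π hπ
  obtain ⟨N, hN⟩ := IsCoatomic.exists_coatom (α := Submodule S L)
  have := isSimpleModule_iff_isCoatom.mpr hN
  obtain ⟨I, hI, ⟨e⟩⟩ := isSimpleModule_iff_quot_maximal.mp this
  obtain rfl := IsLocalRing.eq_maximalIdeal hI
  let φ : (Fin r → S) →ₗ[S] S ⧸ IsLocalRing.maximalIdeal S := e.toLinearMap ∘ₗ N.mkQ ∘ₗ π
  have hφ : Function.Surjective φ :=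
    e.surjective.comp (N.mkQ_surjective.comp hπ)
  have hφB : ∀ b, φ (B.mulVec b) = 0 := fun b => by
    have : B.mulVec b ∈ LinearMap.ker π := hker ▸ ⟨b, rfl⟩
    simp [φ, LinearMap.mem_ker.mp this]
  choose μ hμ using fun i : Fin r =>
    Ideal.Quotient.mk_surjective (φ (Pi.single i 1))
  have hφμ : ∀ y, φ y = Ideal.Quotient.mk _ (∑ i, y i * μ i) := fun y => by
    conv_lhs => rw [← Finset.univ_sum_single y]
    rw [map_sum, map_sum]
    refine Finset.sum_congr rfl fun i _ => ?_
    have : Pi.single i (y i) = y i • (Pi.single i 1 : Fin r → S) := by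
      rw [← Pi.single_smul, smul_eq_mul, mul_one]
    rw [this, map_smul, ← hμ, map_mul]
    rfl
  obtain ⟨g, hg, v, hv⟩ := exists_smul_eq_locVec P.primeCompl μ
  have hmem : ∀ a : T, algebraMap T S a ∈ IsLocalRing.maximalIdeal S ↔ a ∈ P := fun a => by
    rw [← IsLocalization.AtPrime.to_map_mem_maximal_iff S P]
  have hgu : IsUnit (algebraMap T S g) := IsLocalization.map_units S (⟨g, hg⟩ : P.primeCompl)
  refine ⟨v, ?_⟩
  have hv' : ∀ i, algebraMap T S (v i) = algebraMap T S g * μ i := fun i =>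
    (congrFun hv i).symm
  have hex : ∃ j, v j ∉ P := by
    by_contra hall
    push Not at hall
    have hμ0 : ∀ i, μ i ∈ IsLocalRing.maximalIdeal S := fun i => by
      have := (hmem _).mpr (hall i)
      rw [hv'] at this
      exact (Ideal.unit_mul_mem_iff_mem _ hgu).mp this
    obtain ⟨y, hy⟩ := hφ 1
    rw [hφμ, Ideal.Quotient.eq_zero_iff_mem.mpr
      (Ideal.sum_mem _ fun i _ => Ideal.mul_mem_left _ _ (hμ0 i))] at hy
    exact zero_ne_one hy
  obtain ⟨j, hj⟩ := hex
  refine ⟨j, hj, fun i => ?_⟩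
  rw [← hmem]
  have h1 := hφB (Pi.single i 1)
  rw [hφμ, Ideal.Quotient.eq_zero_iff_mem] at h1
  have h2 : algebraMap T S (Matrix.vecMul v A i) =
      algebraMap T S (g * h) * ∑ l, B.mulVec (Pi.single i 1) l * μ l := by
    rw [Matrix.vecMul, dotProduct, map_sum, Finset.mul_sum]
    refine Finset.sum_congr rfl fun l _ => ?_
    rw [map_mul, hv', ← hAB, Matrix.mulVec_single_one, map_mul]
    simp only [Matrix.col_apply]
    ring
  rw [h2]
  exact Ideal.mul_mem_left _ _ h1

theorem nontrivial_of_vecMul_mem (hP : h ∉ P) {v : Fin r → T} {j : Fin r} (hj : v j ∉ P)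
    (hv : ∀ i, (Matrix.vecMul v A) i ∈ P) : Nontrivial L := by
  classical
  by_contra hL
  rw [not_nontrivial_iff_subsingleton] at hL
  have h1 : locVec T S r (Pi.single j 1) ∈ relSub B ((⊥ : Ideal T).map (algebraMap T S)) := by
    refine Submodule.mem_sup_left ?_
    rw [← hker]
    exact LinearMap.mem_ker.mpr (Subsingleton.elim _ _)
  obtain ⟨g, hg, h2⟩ := (locVec_mem_relSub_iff P.primeCompl hP hAB ⊥ _).mp h1
  rw [relSub, Submodule.bot_smul, sup_bot_eq] at h2
  obtain ⟨b, hb⟩ := h2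
  have h3 : v ⬝ᵥ A.mulVec b = g * v j := by
    have : A.mulVec b = g • Pi.single j 1 := hb
    rw [this, dotProduct_smul, dotProduct_single_one, smul_eq_mul]
  rw [Matrix.dotProduct_mulVec] at h3
  have h4 : g * v j ∈ P := by
    rw [← h3]
    exact Ideal.sum_mem _ fun i _ => Ideal.mul_mem_right _ _ (hv i)
  exact (Ideal.IsPrime.mem_or_mem ‹_› h4).elim hg hj

end Nontrivial

end Sat

section PolynomialData

theorem ofList_map_of_associated {S : Type*} [CommRing S] {g : S → S} {rs : List S}
    (h : ∀ x ∈ rs, Associated x (g x)) : Ideal.ofList (rs.map g) = Ideal.ofList rs := by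
  induction rs with
  | nil => rfl
  | cons x rs ih =>
    obtain ⟨u, hu⟩ := h x List.mem_cons_self
    rw [List.map_cons, Ideal.ofList_cons, Ideal.ofList_cons,
      ih fun y hy => h y (List.mem_cons_of_mem _ hy), ← hu,
      Ideal.span_singleton_mul_right_unit u.isUnit]

theorem isWeaklyRegular_map_of_associated {S M : Type*} [CommRing S] [AddCommGroup M] [Module S M]
    {g : S → S} {rs : List S} (h : ∀ x ∈ rs, Associated x (g x))
    (hreg : RingTheory.Sequence.IsWeaklyRegular M rs) :
    RingTheory.Sequence.IsWeaklyRegular M (rs.map g) := by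
  rw [RingTheory.Sequence.isWeaklyRegular_iff] at hreg ⊢
  simp only [List.length_map, List.getElem_map]
  intro i hi
  rw [← List.map_take, ofList_map_of_associated fun x hx => h x (List.mem_of_mem_take hx)]
  obtain ⟨u, hu⟩ := h _ (List.getElem_mem hi)
  rw [← hu]
  exact (hreg i hi).mul (u.isUnit.isSMulRegular _)

variable {T S L : Type} [CommRing T] [CommRing S] [Algebra T S] (P : Ideal T)
  [P.IsPrime] [IsLocalization.AtPrime S P] [IsLocalRing S] [AddCommGroup L] [Module S L] {r s : ℕ}
  {B : Matrix (Fin r) (Fin s) S} {π : (Fin r → S) →ₗ[S] L}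

theorem exists_associated_algebraMap (a : S) (ha : a ∈ IsLocalRing.maximalIdeal S) :
    ∃ x ∈ P, Associated a (algebraMap T S x) := by
  obtain ⟨⟨f, g⟩, hfg⟩ := IsLocalization.surj P.primeCompl a
  have hu : IsUnit (algebraMap T S g) := IsLocalization.map_units S g
  refine ⟨f, ?_, hu.unit, hfg⟩
  rw [← IsLocalization.AtPrime.to_map_mem_maximal_iff S P, ← hfg]
  exact Ideal.mul_mem_right _ _ ha

/-- The Cohen-Macaulay property of a finitely presented module over a localization, expressed by
means of submodules of a free module over the original ring. -/
theorem exists_regular_data [IsNoetherianRing T] (hπ : Function.Surjective π)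
    (hker : LinearMap.ker π = LinearMap.range B.mulVecLin)
    (hCM : (depth S L : WithBot ℕ∞) = moduleDim S L) :
    ∃ h ∉ P, ∃ A : Matrix (Fin r) (Fin s) T,
      (∀ i j, algebraMap T S h * B i j = algebraMap T S (A i j)) ∧
      (∃ (v : Fin r → T) (j : Fin r), v j ∉ P ∧ ∀ i, (Matrix.vecMul v A) i ∈ P) ∧
      ∃ xs : List T, (∀ x ∈ xs, x ∈ P) ∧
        (∀ (i : ℕ) (hi : i < xs.length) (t : Fin r → T),
          xs[i] • t ∈ satSub P.primeCompl (relSub A (Ideal.ofList (xs.take i))) →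
          t ∈ satSub P.primeCompl (relSub A (Ideal.ofList (xs.take i)))) ∧
        ∃ N : ℕ, ∀ a ∈ P ^ N, ∀ t : Fin r → T,
          a • t ∈ satSub P.primeCompl (relSub A (Ideal.ofList xs)) := by
  have : IsNoetherianRing S := IsLocalization.isNoetherianRing P.primeCompl S inferInstance
  have : Module.Finite S L := Module.Finite.of_surjective π hπ
  obtain ⟨h, hh⟩ := IsLocalization.exist_integer_multiples_of_finite P.primeCompl
    (fun ij : Fin r × Fin s => B ij.1 ij.2)
  choose A hA using hh
  have hAB : ∀ i j, algebraMap T S h * B i j = algebraMap T S (A (i, j)) := fun i j => by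
    rw [hA, Algebra.smul_def]
  obtain ⟨hL, rs, hrs, hreg, N, hN⟩ := exists_isRegular_of_depth_eq hCM
  choose! f hfP hf using exists_associated_algebraMap (S := S) P
  have hass : ∀ x ∈ rs, Associated x ((algebraMap T S ∘ f) x) := fun x hx => hf x (hrs x hx)
  have hmap : (rs.map f).map (algebraMap T S) = rs.map (algebraMap T S ∘ f) := List.map_map ..
  refine ⟨h, h.2, fun i j => A (i, j), hAB,
    exists_vecMul_mem_of_nontrivial P hAB hker hπ, rs.map f, ?_, ?_, N, ?_⟩
  · intro x hx
    obtain ⟨y, hy, rfl⟩ := List.mem_map.mp hx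
    exact hfP y (hrs y hy)
  · refine (isWeaklyRegular_map_iff P.primeCompl h.2 hAB hπ hker _).mp ?_
    rw [hmap]
    exact isWeaklyRegular_map_of_associated hass hreg
  · refine (smul_top_le_ofList_map_iff P.primeCompl h.2 hAB hπ hker _ _).mp ?_
    rw [hmap, ofList_map_of_associated hass, Ideal.map_pow,
      IsLocalization.AtPrime.map_eq_maximalIdeal P S]
    exact hN

end PolynomialData

section Core

/-- `mapFam` as a map that is semilinear over the polynomial rings. -/
def polyMapFam {σ ι D E : Type*} [CommRing D] [CommRing E] (ev : D →+* E) :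
    (ι → MvPolynomial σ D) →ₛₗ[MvPolynomial.map (σ := σ) ev] (ι → MvPolynomial σ E) where
  toFun := mapFam ev
  map_add' := map_add _
  map_smul' := mapFam_smul ev

theorem smul_mem_specSub {σ ι D E : Type*} [Finite ι] [CommRing D] [CommRing E] (ev : D →+* E)
    {I : Ideal (MvPolynomial σ D)}
    {U : Submodule (MvPolynomial σ D) (ι → MvPolynomial σ D)}
    (hU : ∀ p ∈ I, ∀ v : ι → MvPolynomial σ D, p • v ∈ U)
    {a : MvPolynomial σ E} (ha : a ∈ I.map (MvPolynomial.map ev)) (v : ι → MvPolynomial σ E) :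
    a • v ∈ specSub ev U := by
  have h1 : I.map (MvPolynomial.map ev) ≤
      (specSub ev U).comap (LinearMap.toSpanSingleton _ _ v) := by
    refine Ideal.map_le_iff_le_comap.mpr fun p hp => ?_
    have h2 : (⊤ : Submodule (MvPolynomial σ E) (ι → MvPolynomial σ E)) ≤
        (specSub ev U).comap (LinearMap.lsmul _ _ (MvPolynomial.map ev p)) := by
      rw [← specSub_top ev]
      refine Submodule.span_le.mpr ?_
      rintro _ ⟨b, -, rfl⟩
      change MvPolynomial.map ev p • mapFam ev b ∈ specSub ev U
      rw [← mapFam_smul]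
      exact mapFam_mem_specSub ev (hU p hp b)
    exact h2 (x := v) trivial
  exact h1 ha

theorem satSub_relSub_map {σ D E : Type*} [CommRing D] [CommRing E] {r s : ℕ} (ev : D →+* E)
    (A : Matrix (Fin r) (Fin s) (MvPolynomial σ D)) (I : Ideal (MvPolynomial σ D))
    {U : Submodule (MvPolynomial σ D) (Fin r → MvPolynomial σ D)} (hU : relSub A I ≤ U)
    {g : MvPolynomial σ D} (hg : ∀ t ∈ U, g • t ∈ relSub A I)
    (M : Submonoid (MvPolynomial σ E)) (hgM : MvPolynomial.map ev g ∈ M) :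
    satSub M (relSub (A.map (MvPolynomial.map ev)) (I.map (MvPolynomial.map ev))) =
      satSub M (specSub ev U) := by
  set W := relSub (A.map (MvPolynomial.map ev)) (I.map (MvPolynomial.map ev)) with hW
  have h1 : W ≤ specSub ev U := by
    refine relSub_le.mpr ⟨fun b => ?_, fun a ha v => ?_⟩
    · have : (⊤ : Submodule (MvPolynomial σ E) (Fin s → MvPolynomial σ E)) ≤
          (specSub ev U).comap (A.map (MvPolynomial.map ev)).mulVecLin := by
        rw [← specSub_top ev]
        refine Submodule.span_le.mpr ?_
        rintro _ ⟨b, -, rfl⟩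
        change (A.map (MvPolynomial.map ev)).mulVec (mapFam ev b) ∈ specSub ev U
        rw [← mapFam_mulVec]
        exact mapFam_mem_specSub ev (hU (mulVec_mem_relSub _ _ _))
      exact this trivial
    · exact smul_mem_specSub ev (fun p hp v => hU (smul_mem_relSub _ hp v)) ha v
  have h2 : ∀ t ∈ specSub ev U, MvPolynomial.map ev g • t ∈ W := by
    have : specSub ev U ≤ W.comap (LinearMap.lsmul _ _ (MvPolynomial.map ev g)) := by
      refine Submodule.span_le.mpr ?_
      rintro _ ⟨t, ht, rfl⟩
      change MvPolynomial.map ev g • mapFam ev t ∈ W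
      rw [← mapFam_smul]
      have h3 : relSub A I ≤ W.comap (polyMapFam ev) := by
        refine relSub_le.mpr ⟨fun b => ?_, fun a ha v => ?_⟩
        · change mapFam ev _ ∈ W
          rw [mapFam_mulVec]
          exact mulVec_mem_relSub _ _ _
        · change mapFam ev _ ∈ W
          rw [mapFam_smul]
          exact smul_mem_relSub _ (Ideal.mem_map_of_mem _ ha) _
      exact h3 (hg t ht)
    exact fun t ht => this ht
  ext t
  constructor
  · rintro ⟨a, ha, hat⟩
    exact ⟨a, ha, h1 hat⟩
  · rintro ⟨a, ha, hat⟩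
    exact ⟨MvPolynomial.map ev g * a, M.mul_mem hgM ha, by rw [mul_smul]; exact h2 _ hat⟩

theorem exists_map_notMem_of_isAssociatedPrime {σ D : Type} [LinearOrder σ] [Finite σ] [CommRing D]
    [IsDomain D] [IsNoetherianRing D] (P : Ideal (MvPolynomial σ D)) [P.IsPrime]
    {g : MvPolynomial σ D} (hg : g ∉ P) :
    ∃ c : D, c ≠ 0 ∧ ∀ {κ : Type} [Field κ] (ev : D →+* κ), ev c ≠ 0 →
      ∀ ℘ : Ideal (MvPolynomial σ κ),
        IsAssociatedPrime ℘ (MvPolynomial σ κ ⧸ P.map (MvPolynomial.map ev)) →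
        MvPolynomial.map ev g ∉ ℘ := by
  obtain ⟨c, hc, h⟩ := exists_isRegular_ideal P g fun y hy =>
    (Ideal.IsPrime.mem_or_mem ‹_› hy).resolve_left hg
  refine ⟨c, hc, fun ev hev ℘ h℘ hmem => ?_⟩
  obtain ⟨z, hz, hz'⟩ := mul_mem_of_isAssociatedPrime h℘
  exact hz (h ev hev z ((hz' _).mp hmem))

theorem exists_maximalIdeal_pow_le {T S : Type*} [CommRing T] [IsNoetherianRing T] [CommRing S]
    [Algebra T S] {I ℘ : Ideal T} [℘.IsPrime] [IsLocalization.AtPrime S ℘] [IsLocalRing S]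
    (h : ℘ ∈ I.minimalPrimes) :
    ∃ N : ℕ, IsLocalRing.maximalIdeal S ^ N ≤ I.map (algebraMap T S) := by
  have : IsNoetherianRing S := IsLocalization.isNoetherianRing ℘.primeCompl S inferInstance
  refine Ideal.exists_pow_le_of_le_radical_of_fg ?_ (IsNoetherian.noetherian _)
  rw [Ideal.radical_eq_sInf]
  refine le_sInf ?_
  rintro 𝔮 ⟨hI𝔮, h𝔮⟩
  have h1 : I ≤ 𝔮.under T := Ideal.map_le_iff_le_comap.mp hI𝔮
  have h2 : 𝔮.under T ≤ ℘ := by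
    intro x hx
    by_contra hx'
    exact h𝔮.ne_top (Ideal.eq_top_of_isUnit_mem _ hx
      (IsLocalization.map_units S (⟨x, hx'⟩ : ℘.primeCompl)))
  have h3 : ℘ ≤ 𝔮.under T := h.2 ⟨inferInstance, h1⟩ h2
  rw [← IsLocalization.AtPrime.map_eq_maximalIdeal ℘ S]
  exact Ideal.map_le_iff_le_comap.mpr h3

/-- The specializations of a module satisfying the conclusion of `exists_regular_data` are
generically Cohen-Macaulay. -/
theorem exists_depth_eq_moduleDim_of_regular_data {σ D : Type} [LinearOrder σ] [Finite σ]
    [CommRing D] [IsDomain D] [IsNoetherianRing D] (P : Ideal (MvPolynomial σ D)) [P.IsPrime]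
    (hP : ∀ d : D, C d ∈ P → d = 0) {r s : ℕ} {h : MvPolynomial σ D} (hh : h ∉ P)
    (A : Matrix (Fin r) (Fin s) (MvPolynomial σ D))
    {v : Fin r → MvPolynomial σ D} {j : Fin r} (hj : v j ∉ P)
    (hv : ∀ i, (Matrix.vecMul v A) i ∈ P) {xs : List (MvPolynomial σ D)} (hxs : ∀ x ∈ xs, x ∈ P)
    (hreg : ∀ (i : ℕ) (hi : i < xs.length) (t : Fin r → MvPolynomial σ D),
      xs[i] • t ∈ satSub P.primeCompl (relSub A (Ideal.ofList (xs.take i))) →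
      t ∈ satSub P.primeCompl (relSub A (Ideal.ofList (xs.take i))))
    {N : ℕ} (hN : ∀ a ∈ P ^ N, ∀ t : Fin r → MvPolynomial σ D,
      a • t ∈ satSub P.primeCompl (relSub A (Ideal.ofList xs))) :
    ∃ c : D, c ≠ 0 ∧ ∀ {κ : Type} [Field κ] (ev : D →+* κ), ev c ≠ 0 →
      ∀ ℘ : Ideal (MvPolynomial σ κ), [℘.IsPrime] →
        IsAssociatedPrime ℘ (MvPolynomial σ κ ⧸ P.map (MvPolynomial.map ev)) →
        MvPolynomial.map ev h ∉ ℘ ∧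
        ∀ {S : Type} [CommRing S] [Algebra (MvPolynomial σ κ) S] [IsLocalization.AtPrime S ℘]
          [IsLocalRing S] (B : Matrix (Fin r) (Fin s) S),
          (∀ i j, algebraMap _ S (MvPolynomial.map ev h) * B i j =
            algebraMap _ S (MvPolynomial.map ev (A i j))) →
          (depth S (MatCoker B) : WithBot ℕ∞) = moduleDim S (MatCoker B) := by
  classical
  let U : ℕ → Submodule (MvPolynomial σ D) (Fin r → MvPolynomial σ D) := fun i =>
    satSub P.primeCompl (relSub A (Ideal.ofList (xs.take i)))
  obtain ⟨c₁, hc₁, H₁⟩ := exists_minimal_specialization P hP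
  have hgen := fun i : Fin xs.length =>
    exists_isRegular_specialization (U i) xs[i] (hreg i i.2)
  choose c hc H using hgen
  choose g hgP hg using fun i =>
    exists_smul_mem_of_satSub P.primeCompl (relSub A (Ideal.ofList (xs.take i)))
  have hprod : h * v j * ∏ i ∈ Finset.range (xs.length + 1), g i ∈ P.primeCompl :=
    Submonoid.mul_mem _ (Submonoid.mul_mem _ hh hj) (Submonoid.prod_mem _ fun i _ => hgP i)
  obtain ⟨c₂, hc₂, H₂⟩ := exists_map_notMem_of_isAssociatedPrime P hprod
  refine ⟨c₁ * c₂ * ∏ i, c i, mul_ne_zero (mul_ne_zero hc₁ hc₂)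
    (Finset.prod_ne_zero_iff.mpr fun i _ => hc i), fun {κ} _ ev hev ℘ _ h℘ => ?_⟩
  rw [map_mul, map_mul, map_prod, mul_ne_zero_iff, mul_ne_zero_iff, Finset.prod_ne_zero_iff] at hev
  have h2 := H₂ ev hev.1.2 ℘ h℘
  rw [map_mul, map_mul, map_prod] at h2
  have hh℘ : MvPolynomial.map ev h ∉ ℘ := fun hm =>
    h2 (Ideal.mul_mem_right _ _ (Ideal.mul_mem_right _ _ hm))
  have hj℘ : MvPolynomial.map ev (v j) ∉ ℘ := fun hm =>
    h2 (Ideal.mul_mem_right _ _ (Ideal.mul_mem_left _ _ hm))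
  have hg℘ : ∀ i ≤ xs.length, MvPolynomial.map ev (g i) ∈ ℘.primeCompl := fun i hi hm =>
    h2 (Ideal.mul_mem_left _ _ (Ideal.mem_of_dvd _
      (Finset.dvd_prod_of_mem _ (Finset.mem_range.mpr (Nat.lt_succ_of_le hi))) hm))
  have hmin := H₁ ev hev.1.1 ℘ h℘
  have hP℘ : ∀ a ∈ P, MvPolynomial.map ev a ∈ ℘ := fun a ha =>
    hmin.1.2 (Ideal.mem_map_of_mem _ ha)
  refine ⟨hh℘, fun {S} _ _ _ _ B hB => ?_⟩
  have hB' : ∀ i j, algebraMap _ S (MvPolynomial.map ev h) * B i j =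
      algebraMap _ S (A.map (MvPolynomial.map ev) i j) := hB
  have hker : LinearMap.ker (LinearMap.range B.mulVecLin).mkQ = LinearMap.range B.mulVecLin :=
    Submodule.ker_mkQ _
  have hsat : ∀ i ≤ xs.length,
      satSub ℘.primeCompl (relSub (A.map (MvPolynomial.map ev))
        (Ideal.ofList ((xs.map (MvPolynomial.map ev)).take i))) =
      satSub ℘.primeCompl (specSub ev (U i)) := fun i hi => by
    rw [← List.map_take, ← Ideal.map_ofList]
    exact satSub_relSub_map ev A _ (le_satSub _ _) (hg i) _ (hg℘ i hi)
  have hnt : Nontrivial (MatCoker B) := by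
    refine nontrivial_of_vecMul_mem ℘ hB' hker hh℘ (v := mapFam ev v) (j := j) hj℘ fun i => ?_
    have : Matrix.vecMul (mapFam ev v) (A.map (MvPolynomial.map ev)) i =
        MvPolynomial.map ev (Matrix.vecMul v A i) := by
      simp [Matrix.vecMul, dotProduct, mapFam_apply]
    rw [this]
    exact hP℘ _ (hv i)
  have hfin : Module.Finite S (MatCoker B) := inferInstance
  have : IsNoetherianRing S := IsLocalization.isNoetherianRing ℘.primeCompl S inferInstance
  obtain ⟨N₁, hN₁⟩ := exists_maximalIdeal_pow_le (S := S) hmin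
  refine depth_eq_moduleDim (rs := (xs.map (MvPolynomial.map ev)).map (algebraMap _ S))
    (N := N₁ * N) ?_ ?_ ?_
  · simp only [List.mem_map, exists_exists_and_eq_and]
    rintro _ ⟨x, hx, rfl⟩
    rw [IsLocalization.AtPrime.to_map_mem_maximal_iff S ℘]
    exact hP℘ x (hxs x hx)
  · refine (isWeaklyRegular_map_iff ℘.primeCompl hh℘ hB' (Submodule.mkQ_surjective _) hker _).mpr
      fun i hi t ht => ?_
    rw [List.length_map] at hi
    rw [hsat i hi.le, mem_satSub] at ht ⊢
    obtain ⟨a, ha, hat⟩ := ht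
    refine ⟨a, ha, H ⟨i, hi⟩ ev (hev.2 _ (Finset.mem_univ _)) _ ?_⟩
    rw [List.getElem_map, smul_comm] at hat
    exact hat
  · rw [pow_mul]
    refine (Submodule.smul_mono_left (Ideal.pow_right_mono hN₁ N)).trans ?_
    rw [← Ideal.map_pow]
    refine (smul_top_le_ofList_map_iff ℘.primeCompl hh℘ hB' (Submodule.mkQ_surjective _) hker
      _ _).mpr fun a ha t => ?_
    have h3 := hsat xs.length le_rfl
    rw [List.take_of_length_le (by simp)] at h3
    rw [h3]
    refine le_satSub _ _ ?_
    rw [← Ideal.map_pow] at ha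
    refine smul_mem_specSub ev (I := P ^ N) (fun p hp w => ?_) ha t
    simpa [U] using hN p hp w

end Core

section Entries

variable {k K : Type} [Field k] [Field K] [Algebra k K]

theorem toR_injective (m n : ℕ) : Function.Injective (toR k m n) :=
  MvPolynomial.map_injective _ (IsFractionRing.injective _ _)

theorem isLocalization_toR (k : Type) [Field k] (m n : ℕ) :
    @IsLocalization (MvPolynomial (Fin n) (MvPolynomial (Fin m) k)) _
      (Submonoid.map C (nonZeroDivisors (MvPolynomial (Fin m) k))) (Rg k m n) _
      (toR k m n).toAlgebra := by
  have e : (toR k m n).toAlgebra = MvPolynomial.algebraMvPolynomial :=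
    Algebra.algebra_ext _ _ fun x => (RingHom.congr_fun MvPolynomial.algebraMap_def x).symm
  rw [e]
  exact MvPolynomial.isLocalization _ _

theorem LocElemSpec.algebraMap_mul_eq {m n : ℕ} {α : Fin m → K} {P : Ideal (Rg k m n)} [P.IsPrime]
    {℘ : Ideal (Ra k K n α)} [℘.IsPrime]
    {S : Type} [CommRing S] [Algebra (Rg k m n) S] [IsLocalization.AtPrime S P]
    {Sα : Type} [CommRing Sα] [Algebra (Ra k K n α) Sα] [IsLocalization.AtPrime Sα ℘]
    {a : S} {aα : Sα} (ha : LocElemSpec P ℘ a aα)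
    {h f : MvPolynomial (Fin n) (MvPolynomial (Fin m) k)}
    (hf : algebraMap _ S (toR k m n h) * a = algebraMap _ S (toR k m n f)) :
    algebraMap _ Sα (toRa k K n α h) * aα = algebraMap _ Sα (toRa k K n α f) := by
  obtain ⟨f₀, g₀, fα, gα, hg, hgα, ⟨p, q, hq, hp, hpα⟩, ⟨p', q', hq', hp', hpα'⟩, e, eα⟩ := ha
  have hinj : Function.Injective (algebraMap (Rg k m n) S) :=
    IsLocalization.injective S P.primeCompl_le_nonZeroDivisors
  have e₀ : a * algebraMap _ S g₀ = algebraMap _ S f₀ := by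
    rw [e]; exact IsLocalization.mk'_spec S f₀ ⟨g₀, hg⟩
  have eα₀ : aα * algebraMap _ Sα gα = algebraMap _ Sα fα := by
    rw [eα]; exact IsLocalization.mk'_spec Sα fα ⟨gα, hgα⟩
  have h1 : toR k m n h * f₀ = toR k m n f * g₀ := hinj (by
    rw [map_mul, map_mul, ← hf, ← e₀, mul_assoc])
  have hC : ∀ d : MvPolynomial (Fin m) k,
      toR k m n (C d) = C (algebraMap (MvPolynomial (Fin m) k) (kU k m) d) := fun d =>
    MvPolynomial.map_C _ _
  have hCα : ∀ d : MvPolynomial (Fin m) k, toRa k K n α (C d) = C (evalα k K α d) := fun d =>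
    MvPolynomial.map_C _ _
  have h2 : h * p * C q' = f * p' * C q := toR_injective m n (by
    simp only [map_mul, hC, ← hp, ← hp']
    linear_combination (C (algebraMap _ (kU k m) q) * C (algebraMap _ (kU k m) q')) * h1)
  have h3 : toRa k K n α h * fα = toRa k K n α f * gα := by
    have h4 := congrArg (toRa k K n α) h2
    simp only [map_mul, hCα, ← hpα, ← hpα'] at h4
    have hne : (C (evalα k K α q) * C (evalα k K α q') : Ra k K n α) ≠ 0 :=
      mul_ne_zero (by simpa using hq) (by simpa using hq')
    refine mul_left_cancel₀ hne ?_
    linear_combination h4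
  have hu : IsUnit (algebraMap _ Sα gα) :=
    IsLocalization.map_units Sα (⟨gα, hgα⟩ : ℘.primeCompl)
  refine hu.mul_right_cancel ?_
  rw [mul_assoc, eα₀, ← map_mul, ← map_mul, h3]

end Entries

theorem eval_map_algebraMap {k K : Type} [Field k] [Field K] [Algebra k K] {m : ℕ} (α : Fin m → K)
    (c : MvPolynomial (Fin m) k) :
    MvPolynomial.eval α (MvPolynomial.map (algebraMap k K) c) = (evalα k K α c : K) := by
  induction c using MvPolynomial.induction_on with
  | C a => simp [evalα]
  | add p q hp hq => simp [hp, hq]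
  | mul_X p i hp => simp [hp, evalα]

/-- if `L` is a Cohen-Macaulay `S`-module (`depth L = dim L`), then
for almost all `α` the specialization `L_α` is a Cohen-Macaulay `S_α`-module. -/
theorem specialization_preserves_cohen_macaulay
    (k K : Type) [Field k] [Field K] [Algebra k K] [Infinite K] {m n : ℕ}
    (P : Ideal (Rg k m n)) [P.IsPrime]
    (S : Type) [CommRing S] [Algebra (Rg k m n) S] [IsLocalization.AtPrime S P]
    (L : Type) [AddCommGroup L] [Module S L] [Module.Finite S L]
    {rL sL : ℕ} (pL : Present S rL sL L)
    (hCM : (letI : IsLocalRing S := IsLocalization.AtPrime.isLocalRing S P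
      (depth S L : WithBot ℕ∞)) = moduleDim S L) :
    AlmostAll K m fun α =>
      ∀ (℘ : Ideal (Ra k K n α))
        (h℘ : IsAssociatedPrime ℘ ((Ra k K n α) ⧸ idealSpec k K n α P)),
        haveI := h℘.isPrime
        ∀ (Sα : Type) [CommRing Sα] [Algebra (Ra k K n α) Sα]
          [IsLocalization.AtPrime Sα ℘],
          haveI : IsLocalRing Sα := IsLocalization.AtPrime.isLocalRing Sα ℘
          ∀ B : Matrix (Fin rL) (Fin sL) Sα,
          MatSpec (LocElemSpec P ℘) pL.A B →
          (depth Sα (MatCoker B) : WithBot ℕ∞) = moduleDim Sα (MatCoker B) := by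
  let T := MvPolynomial (Fin n) (MvPolynomial (Fin m) k)
  let : Algebra T (Rg k m n) := (toR k m n).toAlgebra
  let : Algebra T S := ((algebraMap (Rg k m n) S).comp (toR k m n)).toAlgebra
  have : IsScalarTower T (Rg k m n) S := IsScalarTower.of_algebraMap_eq' rfl
  have : IsLocalRing S := IsLocalization.AtPrime.isLocalRing S P
  let Q : Ideal T := P.comap (algebraMap T (Rg k m n))
  have hloc : IsLocalization (Submonoid.map C (nonZeroDivisors (MvPolynomial (Fin m) k)))
      (Rg k m n) := isLocalization_toR k m n
  have : IsLocalization.AtPrime S Q :=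
    IsLocalization.isLocalization_isLocalization_atPrime_isLocalization
      (Submonoid.map C (nonZeroDivisors (MvPolynomial (Fin m) k))) S P
  have hQ : ∀ d : MvPolynomial (Fin m) k, C d ∈ Q → d = 0 := by
    intro d hd
    by_contra hne
    have hd' : toR k m n (C d) ∈ P := hd
    refine Ideal.IsPrime.ne_top ‹P.IsPrime› (Ideal.eq_top_of_isUnit_mem _ hd' ?_)
    rw [toR, MvPolynomial.map_C]
    refine IsUnit.map _ (isUnit_iff_ne_zero.mpr ?_)
    simpa using hne
  obtain ⟨h, hh, A, hA, ⟨v, j, hj, hv⟩, xs, hxs, hreg, N, hN⟩ :=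
    exists_regular_data (L := L) Q pL.surj pL.ker_eq hCM
  obtain ⟨c, hc, H⟩ := exists_depth_eq_moduleDim_of_regular_data Q hQ hh A hj hv hxs hreg hN
  refine ⟨MvPolynomial.map (algebraMap k K) c, ?_, fun α hα ℘ h℘ => ?_⟩
  · exact (map_ne_zero_iff _ (MvPolynomial.map_injective _ (algebraMap k K).injective)).mpr hc
  · rw [eval_map_algebraMap] at hα
    have := h℘.isPrime
    intro Sα _ _ _
    have : IsLocalRing Sα := IsLocalization.AtPrime.isLocalRing Sα ℘
    intro B hB
    refine (H (evalα k K α) (fun h0 => hα (by rw [h0]; rfl)) ℘ h℘).2 B fun i j => ?_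
    exact (hB i j).algebraMap_mul_eq (hA i j)

end Spl
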